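/- arXiv:1306.1278 — 6 statements merged into one kernel-verified Lean document; each statement's English description precedes it below -/
import Mathlib

section
/- Let M, L > 0 and let u : ℝ × [0,T) → ℝ be a smooth solution of the curve-shortening flow ∂_t u = ∂²_x u / (1 + (∂_x u)²) which is L-periodic in x (u(x+L,t) = u(x,t)) and satisfies osc u(·,t) := sup u(·,t) − inf u(·,t) ≤ M for all t. Let φ : [0,∞) × (0,∞) → ℝ be a nonnegative regular solution of the same equation ∂_t φ = ∂²_x φ/(1+(∂_x φ)²) such that φ(x,t) → 1/2 as t → 0⁺ locally uniformly for x > 0, φ(0,t) = 0 for every t > 0, and φ(x,t) → 1/2 as x → ∞ for each t > 0. Then for all x ≠ y in ℝ and all 0 < t < T, |u(y,t) − u(x,t)| ≤ 2M φ(|y−x|/(2M), t/M²). -/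
open Set Real Filter

/-- Partial derivative in the spatial variable. -/
noncomputable def pderivX (u : ℝ → ℝ → ℝ) (x t : ℝ) : ℝ := deriv (fun y => u y t) x

/-- Second partial derivative in the spatial variable. -/
noncomputable def pderivXX (u : ℝ → ℝ → ℝ) (x t : ℝ) : ℝ := deriv (fun y => pderivX u y t) x

/-- Partial derivative in the time variable. -/
noncomputable def pderivT (u : ℝ → ℝ → ℝ) (x t : ℝ) : ℝ := deriv (fun s => u x s) t

/-- `u` is regular on `S`: it is continuous, has spatial derivatives up to second order and a
first time derivative on `S`, and these are continuous on `S`. -/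
def RegularOn (u : ℝ → ℝ → ℝ) (S : Set (ℝ × ℝ)) : Prop :=
  ContinuousOn (fun p : ℝ × ℝ => u p.1 p.2) S ∧
  (∀ p ∈ S, DifferentiableAt ℝ (fun y => u y p.2) p.1) ∧
  (∀ p ∈ S, DifferentiableAt ℝ (fun y => pderivX u y p.2) p.1) ∧
  (∀ p ∈ S, DifferentiableAt ℝ (fun s => u p.1 s) p.2) ∧
  ContinuousOn (fun p : ℝ × ℝ => pderivX u p.1 p.2) S ∧
  ContinuousOn (fun p : ℝ × ℝ => pderivXX u p.1 p.2) S ∧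
  ContinuousOn (fun p : ℝ × ℝ => pderivT u p.1 p.2) S

/-- Second derivative test: at a local maximum the second derivative is nonpositive. -/
theorem second_deriv_nonpos_of_isLocalMax {g g' : ℝ → ℝ} {a c : ℝ}
    (hg : ∀ᶠ s in nhds a, HasDerivAt g (g' s) s) (hg' : HasDerivAt g' c a)
    (hmax : IsLocalMax g a) : c ≤ 0 := by
  by_contra! hc
  have hderiv : deriv g =ᶠ[nhds a] g' := hg.mono fun s hs => hs.deriv
  have hdd : deriv (deriv g) a = c := by rw [hderiv.deriv_eq, hg'.deriv]
  have hmin : IsLocalMin g a :=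
    isLocalMin_of_deriv_deriv_pos (by rw [hdd]; exact hc) hmax.deriv_eq_zero
      hg.self_of_nhds.continuousAt
  have hconst : g =ᶠ[nhds a] fun _ => g a := by
    filter_upwards [hmax, hmin] with s h₁ h₂ using le_antisymm h₁ h₂
  have hzero : deriv g =ᶠ[nhds a] fun _ => 0 := by
    simpa using hconst.deriv
  have := hzero.deriv_eq
  simp only [deriv_const] at this
  linarith

/-- If `f` attains a maximum on `[b, a]` at the right endpoint, its derivative there is
nonnegative. -/
theorem deriv_nonneg_of_le_of_left {f : ℝ → ℝ} {a b c : ℝ} (hb : b < a)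
    (hf : HasDerivAt f c a) (hmax : ∀ s ∈ Icc b a, f s ≤ f a) : 0 ≤ c := by
  have hslope := (hasDerivWithinAt_iff_tendsto_slope' (s := Iio a) (by simp)).1
    hf.hasDerivWithinAt
  refine ge_of_tendsto hslope ?_
  filter_upwards [Ioo_mem_nhdsLT hb] with s hs
  rw [slope_def_field]
  exact div_nonneg_of_nonpos (by linarith [hmax s ⟨hs.1.le, hs.2.le⟩]) (by linarith [hs.2])

/-- Comparison of the two-point function of a periodic solution of curve shortening flow with
a solution `ψ` of the time-rescaled flow (by a factor four) on a bounded interval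
`(0, D)`, where `D` is a period of the solution. -/
theorem two_point_comparison {M L D T : ℝ} (hL : 0 < L)
    {u ux uxx ut ψ ψx ψxx ψt : ℝ → ℝ → ℝ}
    (hu_cont : ContinuousOn (fun p : ℝ × ℝ => u p.1 p.2) (univ ×ˢ Ico 0 T))
    (hux : ∀ x t, 0 < t → t < T → HasDerivAt (fun y => u y t) (ux x t) x)
    (huxx : ∀ x t, 0 < t → t < T → HasDerivAt (fun y => ux y t) (uxx x t) x)
    (hut : ∀ x t, 0 < t → t < T → HasDerivAt (fun s => u x s) (ut x t) t)
    (hu_eq : ∀ x t, 0 < t → t < T → ut x t = uxx x t / (1 + ux x t ^ 2))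
    (hu_per : ∀ x t, u (x + L) t = u x t) (hu_perD : ∀ x t, u (x + D) t = u x t)
    (hu_osc : ∀ x y, ∀ t ∈ Ico (0:ℝ) T, u y t - u x t ≤ M)
    (hψ_cont : ContinuousOn (fun p : ℝ × ℝ => ψ p.1 p.2) (Ioi 0 ×ˢ Ioi 0))
    (hψ_nonneg : ∀ d t, 0 < d → 0 < t → 0 ≤ ψ d t)
    (hψx : ∀ d t, 0 < d → 0 < t → HasDerivAt (fun y => ψ y t) (ψx d t) d)
    (hψxx : ∀ d t, 0 < d → 0 < t → HasDerivAt (fun y => ψx y t) (ψxx d t) d)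
    (hψt : ∀ d t, 0 < d → 0 < t → HasDerivAt (fun s => ψ d s) (ψt d t) t)
    (hψ_eq : ∀ d t, 0 < d → 0 < t → ψt d t = 4 * ψxx d t / (1 + ψx d t ^ 2))
    (hψ_init : ∀ δ > 0, ∀ ε > 0, ∀ᶠ τ in nhdsWithin (0:ℝ) (Ioi 0),
      ∀ d ∈ Icc δ D, M - ε ≤ ψ d τ)
    {x₁ d₁ t₁ : ℝ} (hd₁ : 0 < d₁) (hdD : d₁ ≤ D) (ht₁ : 0 < t₁) (htT : t₁ < T) :
    u (x₁ + d₁) t₁ - u x₁ t₁ ≤ ψ d₁ t₁ := by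
  suffices H : ∀ ε > 0, u (x₁ + d₁) t₁ - u x₁ t₁ - ψ d₁ t₁ - ε * (1 + t₁) ≤ 0 by
    refine le_of_forall_pos_le_add fun η hη => ?_
    have := H (η / (1 + t₁)) (by positivity)
    rw [div_mul_cancel₀ _ (by positivity)] at this
    linarith
  intro ε hε
  obtain ⟨δ, hδ, hδd, hδε⟩ : ∃ δ > 0, δ ≤ d₁ ∧
      ∀ x ∈ Icc 0 L, ∀ t ∈ Icc 0 t₁, u (x + δ) t - u x t ≤ ε := by
    have huc : UniformContinuousOn (fun p : ℝ × ℝ => u p.1 p.2)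
        (Icc 0 (L + d₁) ×ˢ Icc 0 t₁) :=
      (isCompact_Icc.prod isCompact_Icc).uniformContinuousOn_of_continuous
        (hu_cont.mono (prod_mono (subset_univ _) fun t ht => ⟨ht.1, ht.2.trans_lt htT⟩))
    obtain ⟨δ, hδ, h⟩ := Metric.uniformContinuousOn_iff.1 huc ε hε
    refine ⟨min (δ / 2) d₁, by positivity, min_le_right _ _, fun x hx t ht => ?_⟩
    have h0 : 0 < min (δ / 2) d₁ := by positivity
    have h1 := min_le_right (δ / 2) d₁
    have h2 := min_le_left (δ / 2) d₁
    have := h (x + min (δ / 2) d₁, t) ⟨⟨by linarith [hx.1], by linarith [hx.2]⟩, ht⟩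
      (x, t) ⟨⟨hx.1, by linarith [hx.2]⟩, ht⟩ (by
        simp only [Prod.dist_eq, Real.dist_eq, sub_self, abs_zero, add_sub_cancel_left,
          abs_of_pos h0]
        exact max_lt (by linarith) hδ)
    rw [Real.dist_eq] at this
    exact (le_abs_self _).trans this.le
  obtain ⟨τ, hτε, hτ⟩ : ∃ τ, (∀ d ∈ Icc δ D, M - ε ≤ ψ d τ) ∧ τ ∈ Ioo 0 t₁ :=
    ((hψ_init δ hδ ε hε).and (Ioo_mem_nhdsGT ht₁)).exists
  set W : ℝ × ℝ × ℝ → ℝ := fun p =>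
    u (p.1 + p.2.1) p.2.2 - u p.1 p.2.2 - ψ p.2.1 p.2.2 - ε * (1 + p.2.2) with hW
  set K : Set (ℝ × ℝ × ℝ) := Icc 0 L ×ˢ Icc δ D ×ˢ Icc τ t₁ with hK
  have hKcont : ContinuousOn W K := by
    have hmemT : ∀ p ∈ K, p.2.2 ∈ Ico 0 T := fun p hp =>
      ⟨hτ.1.le.trans hp.2.2.1, hp.2.2.2.trans_lt htT⟩
    have h1 : ContinuousOn (fun p : ℝ × ℝ × ℝ => u (p.1 + p.2.1) p.2.2) K :=
      hu_cont.comp (f := fun p : ℝ × ℝ × ℝ => (p.1 + p.2.1, p.2.2)) (by fun_prop)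
        fun p hp => ⟨mem_univ _, hmemT p hp⟩
    have h2 : ContinuousOn (fun p : ℝ × ℝ × ℝ => u p.1 p.2.2) K :=
      hu_cont.comp (f := fun p : ℝ × ℝ × ℝ => (p.1, p.2.2)) (by fun_prop)
        fun p hp => ⟨mem_univ _, hmemT p hp⟩
    have h3 : ContinuousOn (fun p : ℝ × ℝ × ℝ => ψ p.2.1 p.2.2) K :=
      hψ_cont.comp (f := fun p : ℝ × ℝ × ℝ => (p.2.1, p.2.2)) (by fun_prop)
        fun p hp => ⟨hδ.trans_le hp.2.1.1, hτ.1.trans_le hp.2.2.1⟩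
    exact ((h1.sub h2).sub h3).sub (by fun_prop)
  have hperiodic : ∀ d t, Function.Periodic (fun x => u (x + d) t - u x t) L := fun d t x => by
    simp only [hu_per, add_right_comm x L d]
  obtain ⟨⟨x₀, d₀, t₀⟩, ⟨hx₀, hd₀, ht₀⟩, hmaxK⟩ :=
    (isCompact_Icc.prod (isCompact_Icc.prod isCompact_Icc)).exists_isMaxOn
      (⟨(0, d₁, t₁), ⟨le_rfl, hL.le⟩, ⟨hδd, hdD⟩, ⟨hτ.2.le, le_rfl⟩⟩ : K.Nonempty) hKcont
  have hmax : ∀ x, ∀ d ∈ Icc δ D, ∀ t ∈ Icc τ t₁, W (x, d, t) ≤ W (x₀, d₀, t₀) := by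
    intro x d hd t ht
    obtain ⟨y, hy, hxy⟩ := (hperiodic d t).exists_mem_Ico₀ hL x
    have := hmaxK (show (y, d, t) ∈ K from ⟨⟨hy.1, hy.2.le⟩, hd, ht⟩)
    simp only [mem_ofPred_eq, hW] at this hxy ⊢
    linarith
  refine (hmax x₁ d₁ ⟨hδd, hdD⟩ t₁ ⟨hτ.2.le, le_rfl⟩).trans ?_
  by_contra! hpos
  simp only at hx₀ hd₀ ht₀
  have hd₀' : 0 < d₀ := hδ.trans_le hd₀.1
  have ht₀' : 0 < t₀ := hτ.1.trans_le ht₀.1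
  have ht₀T : t₀ < T := ht₀.2.trans_lt htT
  have hεt : 0 < ε * t₀ := by positivity
  have hψ0 := hψ_nonneg d₀ t₀ hd₀' ht₀'
  have hδd₀ : δ < d₀ := by
    refine lt_of_le_of_ne hd₀.1 fun h => ?_
    have := hδε x₀ hx₀ t₀ ⟨ht₀'.le, ht₀.2⟩
    rw [h] at this
    simp only [hW] at hpos
    linarith
  have hd₀D : d₀ < D := by
    refine lt_of_le_of_ne hd₀.2 fun h => ?_
    have := hu_perD x₀ t₀
    rw [← h] at this
    simp only [hW] at hpos
    linarith
  have hτt₀ : τ < t₀ := by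
    refine lt_of_le_of_ne ht₀.1 fun h => ?_
    have h1 := hτε d₀ hd₀
    have h2 := hu_osc x₀ (x₀ + d₀) t₀ ⟨ht₀'.le, ht₀T⟩
    rw [h] at h1
    simp only [hW] at hpos
    linarith
  have htime : 0 ≤ ut (x₀ + d₀) t₀ - ut x₀ t₀ - ψt d₀ t₀ - ε * 1 := by
    refine deriv_nonneg_of_le_of_left (f := fun t => W (x₀, d₀, t)) hτt₀ ?_
      fun s hs => hmax x₀ d₀ hd₀ s ⟨hs.1, hs.2.trans ht₀.2⟩
    show HasDerivAt (fun t => u (x₀ + d₀) t - u x₀ t - ψ d₀ t - ε * (1 + t)) _ t₀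
    exact (((hut _ _ ht₀' ht₀T).sub (hut _ _ ht₀' ht₀T)).sub (hψt _ _ hd₀' ht₀')).sub
      (((hasDerivAt_id t₀).const_add 1).const_mul ε)
  have hfirst : ux (x₀ + d₀) t₀ - ux x₀ t₀ = 0 := by
    refine IsLocalMax.hasDerivAt_eq_zero (f := fun x => W (x, d₀, t₀)) (a := x₀)
      (Eventually.of_forall fun x => hmax x d₀ hd₀ t₀ ht₀) ?_
    show HasDerivAt (fun x => u (x + d₀) t₀ - u x t₀ - ψ d₀ t₀ - ε * (1 + t₀)) _ x₀
    exact ((((hux _ _ ht₀' ht₀T).comp_add_const x₀ d₀).sub (hux _ _ ht₀' ht₀T)).sub_const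
      _).sub_const _
  have hfirst' : ux (x₀ + d₀) t₀ - ψx d₀ t₀ = 0 := by
    refine IsLocalMax.hasDerivAt_eq_zero (f := fun d => W (x₀, d, t₀)) (a := d₀) ?_ ?_
    · filter_upwards [Icc_mem_nhds hδd₀ hd₀D] with d hd using hmax x₀ d hd t₀ ht₀
    · show HasDerivAt (fun d => u (x₀ + d) t₀ - u x₀ t₀ - ψ d t₀ - ε * (1 + t₀)) _ d₀
      exact ((((hux _ _ ht₀' ht₀T).comp_const_add x₀ d₀).sub_const _).sub
        (hψx _ _ hd₀' ht₀')).sub_const _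
  have hlin : ∀ s : ℝ, HasDerivAt (fun s : ℝ => d₀ + 2 * s) (2 * 1) s := fun s =>
    ((hasDerivAt_id s).const_mul 2).const_add d₀
  have hplus : ∀ s : ℝ, HasDerivAt (fun s : ℝ => x₀ + d₀ + s) 1 s := fun s =>
    (hasDerivAt_id s).const_add _
  have hminus : ∀ s : ℝ, HasDerivAt (fun s : ℝ => x₀ - s) (-1) s := fun s =>
    (hasDerivAt_id s).const_sub _
  have hnear : ∀ᶠ s in nhds (0:ℝ), d₀ + 2 * s ∈ Ioo δ D :=
    (hlin 0).continuousAt.eventually_mem (by simpa using Ioo_mem_nhds hδd₀ hd₀D)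
  have hsecond : (uxx (x₀ + d₀ + 0) t₀ * 1 + uxx (x₀ - 0) t₀ * (-1))
      - 2 * (ψxx (d₀ + 2 * 0) t₀ * (2 * 1)) ≤ 0 := by
    refine second_deriv_nonpos_of_isLocalMax (a := 0)
      (g := fun s => u (x₀ + d₀ + s) t₀ - u (x₀ - s) t₀ - ψ (d₀ + 2 * s) t₀)
      (g' := fun s => (ux (x₀ + d₀ + s) t₀ + ux (x₀ - s) t₀) - 2 * ψx (d₀ + 2 * s) t₀)
      ?_ ?_ ?_
    · filter_upwards [hnear] with s hs
      have h1 := (hux (x₀ + d₀ + s) t₀ ht₀' ht₀T).comp s (hplus s)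
      have h2 := (hux (x₀ - s) t₀ ht₀' ht₀T).comp s (hminus s)
      have h3 := (hψx (d₀ + 2 * s) t₀ (hδ.trans hs.1) ht₀').comp s (hlin s)
      exact ((h1.sub h2).sub h3).congr_deriv (by ring)
    · have h1 := (huxx (x₀ + d₀ + 0) t₀ ht₀' ht₀T).comp 0 (hplus 0)
      have h2 := (huxx (x₀ - 0) t₀ ht₀' ht₀T).comp 0 (hminus 0)
      have h3 := (hψxx (d₀ + 2 * 0) t₀ (by simpa using hd₀') ht₀').comp 0 (hlin 0)
      exact (h1.add h2).sub (h3.const_mul 2)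
    · filter_upwards [hnear] with s hs
      have := hmax (x₀ - s) (d₀ + 2 * s) ⟨hs.1.le, hs.2.le⟩ t₀ ht₀
      simp only [hW, show x₀ - s + (d₀ + 2 * s) = x₀ + d₀ + s by ring] at this
      simp only [mul_zero, add_zero, sub_zero]
      linarith
  simp only [mul_zero, add_zero, sub_zero] at hsecond
  rw [hu_eq _ _ ht₀' ht₀T, hu_eq _ _ ht₀' ht₀T, hψ_eq _ _ hd₀' ht₀',
    ← sub_eq_zero.1 hfirst, ← sub_eq_zero.1 hfirst', ← sub_div, ← sub_div] at htime
  have := div_nonpos_of_nonpos_of_nonneg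
    (show uxx (x₀ + d₀) t₀ - uxx x₀ t₀ - 4 * ψxx d₀ t₀ ≤ 0 by linarith)
    (show 0 ≤ 1 + ux (x₀ + d₀) t₀ ^ 2 by positivity)
  linarith

theorem modulus_bound_curve_shortening
    (M L T : ℝ) (hM : 0 < M) (hL : 0 < L) (hT : 0 < T)
    (u φ : ℝ → ℝ → ℝ)
    (hu_smooth : ContDiffOn ℝ (⊤ : ℕ∞) (fun p : ℝ × ℝ => u p.1 p.2) (univ ×ˢ Ico 0 T))
    (hu_eq : ∀ x : ℝ, ∀ t ∈ Ico (0:ℝ) T,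
      pderivT u x t = pderivXX u x t / (1 + (pderivX u x t)^2))
    (hu_per : ∀ x t : ℝ, u (x + L) t = u x t)
    (hu_osc : ∀ x y : ℝ, ∀ t ∈ Ico (0:ℝ) T, u y t - u x t ≤ M)
    (hφ_nonneg : ∀ x t : ℝ, 0 ≤ x → 0 < t → 0 ≤ φ x t)
    (hφ_cont : ContinuousOn (fun p : ℝ × ℝ => φ p.1 p.2) (Ici 0 ×ˢ Ioi 0))
    (hφ_reg : RegularOn φ (Ioi 0 ×ˢ Ioi 0))
    (hφ_eq : ∀ x t : ℝ, 0 < x → 0 < t →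
      pderivT φ x t = pderivXX φ x t / (1 + (pderivX φ x t)^2))
    (hφ_init : TendstoLocallyUniformlyOn (fun t x => φ x t) (fun _ => (1:ℝ)/2)
      (nhdsWithin 0 (Ioi 0)) (Ioi 0))
    (hφ_bdry : ∀ t : ℝ, 0 < t → φ 0 t = 0)
    (hφ_inf : ∀ t : ℝ, 0 < t → Tendsto (fun x => φ x t) atTop (nhds ((1:ℝ)/2))) :
    ∀ x y t : ℝ, x ≠ y → 0 < t → t < T →
      |u y t - u x t| ≤ 2 * M * φ (|y - x| / (2 * M)) (t / M^2) := by
  intro x y t hxy ht htT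
  wlog hlt : x < y generalizing x y
  · rw [abs_sub_comm (u y t), abs_sub_comm y x]
    exact this y x hxy.symm (lt_of_le_of_ne (not_lt.1 hlt) hxy.symm)
  have hd : 0 < y - x := sub_pos.2 hlt
  rw [abs_of_pos hd]
  have hC : ∀ s, 0 < s → s < T → ContDiff ℝ 2 (fun z => u z s) := fun s hs hsT =>
    contDiff_iff_contDiffAt.2 fun z =>
      ((contDiffOn_infty.1 hu_smooth 2).contDiffAt
        (prod_mem_nhds univ_mem (Ico_mem_nhds hs hsT))).comp
          (f := fun z : ℝ => (z, s)) z (by fun_prop)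
  have hux : ∀ z s, 0 < s → s < T → HasDerivAt (fun z => u z s) (pderivX u z s) z :=
    fun z s hs hsT => ((hC s hs hsT).differentiable (by norm_num) z).hasDerivAt
  have huxx : ∀ z s, 0 < s → s < T → HasDerivAt (fun z => pderivX u z s) (pderivXX u z s) z :=
    fun z s hs hsT => ((hC s hs hsT).differentiable_deriv_two z).hasDerivAt
  have hut : ∀ z s, 0 < s → s < T → HasDerivAt (fun s => u z s) (pderivT u z s) s :=
    fun z s hs hsT =>
      (((hu_smooth.contDiffAt (prod_mem_nhds univ_mem (Ico_mem_nhds hs hsT))).comp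
        (f := fun s : ℝ => (z, s)) s (by fun_prop)).differentiableAt (by simp)).hasDerivAt
  obtain ⟨-, hφx, hφxx, hφt, -, -, -⟩ := hφ_reg
  have hscale : ∀ r, 0 < r → 0 < r / (2 * M) := fun r hr => by positivity
  have hscale' : ∀ s, 0 < s → 0 < s / M ^ 2 := fun s hs => by positivity
  have hψ_cont : ContinuousOn
      (fun p : ℝ × ℝ => 2 * M * φ (p.1 / (2 * M)) (p.2 / M ^ 2)) (Ioi 0 ×ˢ Ioi 0) :=
    (hφ_cont.comp (f := fun p : ℝ × ℝ => (p.1 / (2 * M), p.2 / M ^ 2)) (by fun_prop)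
      fun p hp => ⟨(hscale _ hp.1).le, hscale' _ hp.2⟩).const_mul (2 * M)
  have hψ_nonneg : ∀ r s, 0 < r → 0 < s → 0 ≤ 2 * M * φ (r / (2 * M)) (s / M ^ 2) :=
    fun r s hr hs => mul_nonneg (by positivity) (hφ_nonneg _ _ (hscale r hr).le (hscale' s hs))
  have hψx : ∀ r s, 0 < r → 0 < s →
      HasDerivAt (fun r => 2 * M * φ (r / (2 * M)) (s / M ^ 2))
        (pderivX φ (r / (2 * M)) (s / M ^ 2)) r := fun r s hr hs =>
    (((hφx (_, _) ⟨hscale r hr, hscale' s hs⟩).hasDerivAt.comp r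
      ((hasDerivAt_id r).div_const (2 * M))).const_mul (2 * M)).congr_deriv (by
        simp only [pderivX]; field_simp)
  have hψxx : ∀ r s, 0 < r → 0 < s →
      HasDerivAt (fun r => pderivX φ (r / (2 * M)) (s / M ^ 2))
        (pderivXX φ (r / (2 * M)) (s / M ^ 2) / (2 * M)) r := fun r s hr hs =>
    ((hφxx (_, _) ⟨hscale r hr, hscale' s hs⟩).hasDerivAt.comp r
      ((hasDerivAt_id r).div_const (2 * M))).congr_deriv (by
        simp only [pderivXX]; ring)
  have hψt : ∀ r s, 0 < r → 0 < s →
      HasDerivAt (fun s => 2 * M * φ (r / (2 * M)) (s / M ^ 2))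
        (2 / M * pderivT φ (r / (2 * M)) (s / M ^ 2)) s := fun r s hr hs =>
    (((hφt (_, _) ⟨hscale r hr, hscale' s hs⟩).hasDerivAt.comp s
      ((hasDerivAt_id s).div_const (M ^ 2))).const_mul (2 * M)).congr_deriv (by
        simp only [pderivT]; field_simp)
  have hψ_eq : ∀ r s, 0 < r → 0 < s → 2 / M * pderivT φ (r / (2 * M)) (s / M ^ 2) =
      4 * (pderivXX φ (r / (2 * M)) (s / M ^ 2) / (2 * M)) /
        (1 + pderivX φ (r / (2 * M)) (s / M ^ 2) ^ 2) := fun r s hr hs => by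
    rw [hφ_eq _ _ (hscale r hr) (hscale' s hs)]
    ring
  obtain ⟨n, hn⟩ := exists_nat_ge ((y - x) / L)
  have hdD : y - x ≤ ((n + 1 : ℕ) : ℝ) * L := by
    rw [div_le_iff₀ hL] at hn
    push_cast
    linarith
  have hperD : ∀ z s, u (z + ((n + 1 : ℕ) : ℝ) * L) s = u z s := fun z s =>
    Function.Periodic.nat_mul (f := fun z => u z s) (fun z => hu_per z s) (n + 1) z
  have hψ_init : ∀ δ > 0, ∀ ε > 0, ∀ᶠ τ in nhdsWithin (0:ℝ) (Ioi 0),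
      ∀ r ∈ Icc δ (((n + 1 : ℕ) : ℝ) * L),
        M - ε ≤ 2 * M * φ (r / (2 * M)) (τ / M ^ 2) := by
    intro δ hδ ε hε
    have hunif := Metric.tendstoUniformlyOn_iff.1
      ((tendstoLocallyUniformlyOn_iff_forall_isCompact isOpen_Ioi).1 hφ_init
        (Icc (δ / (2 * M)) (((n + 1 : ℕ) : ℝ) * L / (2 * M)))
        (fun z hz => (hscale δ hδ).trans_le hz.1) isCompact_Icc) (ε / (2 * M)) (hscale ε hε)
    have htend : Tendsto (fun τ : ℝ => τ / M ^ 2) (nhdsWithin 0 (Ioi 0))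
        (nhdsWithin 0 (Ioi 0)) := by
      refine tendsto_nhdsWithin_of_tendsto_nhds_of_eventually_within _ ?_ ?_
      · have : ContinuousAt (fun τ : ℝ => τ / M ^ 2) 0 := by fun_prop
        simpa using this.tendsto.mono_left (nhdsWithin_le_nhds (s := Ioi 0))
      · filter_upwards [self_mem_nhdsWithin] with τ hτ using hscale' τ hτ
    filter_upwards [htend.eventually hunif] with τ hτ r hr
    have h := hτ (r / (2 * M)) ⟨by have := hr.1; gcongr, by have := hr.2; gcongr⟩
    rw [Real.dist_eq] at h
    have h' := (le_abs_self _).trans_lt h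
    rw [lt_div_iff₀ (by positivity)] at h'
    linarith
  have hupper := two_point_comparison (x₁ := x) hL hu_smooth.continuousOn hux huxx hut
    (fun z s hs hsT => hu_eq z s ⟨hs.le, hsT⟩) hu_per hperD hu_osc hψ_cont hψ_nonneg hψx hψxx
    hψt hψ_eq hψ_init hd hdD ht htT
  have hlower := two_point_comparison (x₁ := x) (u := fun z s => -u z s) hL
    hu_smooth.continuousOn.neg
    (fun z s hs hsT => (hux z s hs hsT).fun_neg) (fun z s hs hsT => (huxx z s hs hsT).fun_neg)
    (fun z s hs hsT => (hut z s hs hsT).fun_neg)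
    (fun z s hs hsT => by rw [hu_eq z s ⟨hs.le, hsT⟩, neg_sq, neg_div])
    (fun z s => by rw [hu_per]) (fun z s => by rw [hperD])
    (fun z w s hs => by linarith [hu_osc w z s hs]) hψ_cont hψ_nonneg hψx hψxx
    hψt hψ_eq hψ_init hd hdD ht htT
  simp only [add_sub_cancel] at hupper hlower
  exact abs_le.2 ⟨by linarith, hupper⟩
end

section
/- Let M, L > 0 and let u : ℝ × [0,T) → ℝ be a smooth solution of the curve-shortening flow ∂_t u = ∂²_x u/(1+(∂_x u)²) which is L-periodic in x and satisfies osc u(·,t) ≤ M for all t. Then there exist constants C₁ and C₂ depending only on M such that for all x ∈ ℝ and all 0 < t < T, |∂_x u(x,t)| ≤ C₁(1 + t^{3/2} exp(C₂/t)). -/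
open Set Real Filter

open Topology

/-- Second-derivative test: the second derivative is nonpositive at a local maximum. -/
theorem second_deriv_nonpos_of_isLocalMax_s1 {f f' : ℝ → ℝ} {c x : ℝ}
    (hf : ∀ s, HasDerivAt f (f' s) s) (hf' : HasDerivAt f' c x) (hmax : IsLocalMax f x) :
    c ≤ 0 := by
  by_contra! hc
  have hd : deriv f = f' := funext fun s => (hf s).deriv
  have hmin : IsLocalMin f x := by
    refine isLocalMin_of_deriv_deriv_pos ?_ hmax.deriv_eq_zero (hf x).continuousAt
    rwa [hd, hf'.deriv]
  have hconst : f =ᶠ[𝓝 x] fun _ => f x := by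
    filter_upwards [hmax, hmin] with s h₁ h₂ using le_antisymm h₁ h₂
  have hzero : deriv (deriv f) x = 0 := by
    rw [hconst.deriv.deriv_eq]
    simp
  rw [hd, hf'.deriv] at hzero
  exact hc.ne' hzero

/-- A function maximal at `t` among nearby earlier times has nonnegative derivative at `t`. -/
theorem deriv_nonneg_of_eventually_le_left {f : ℝ → ℝ} {c t : ℝ} (hf : HasDerivAt f c t)
    (hle : ∀ᶠ s in 𝓝[<] t, f s ≤ f t) : 0 ≤ c := by
  have hslope : Tendsto (slope f t) (𝓝[<] t) (𝓝 c) :=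
    (hasDerivAt_iff_tendsto_slope.1 hf).mono_left
      (nhdsWithin_mono t fun s hs => ne_of_lt hs)
  refine ge_of_tendsto hslope ?_
  filter_upwards [hle, self_mem_nhdsWithin] with s h₁ (h₂ : s < t)
  rw [slope_def_field]
  exact div_nonneg_of_nonpos (by linarith) (by linarith)

/-- A function maximal at `x` among nearby points on the right has nonpositive derivative at `x`. -/
theorem deriv_nonpos_of_eventually_le_right {f : ℝ → ℝ} {c x : ℝ} (hf : HasDerivAt f c x)
    (hle : ∀ᶠ s in 𝓝[>] x, f s ≤ f x) : c ≤ 0 := by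
  have hslope : Tendsto (slope f x) (𝓝[>] x) (𝓝 c) :=
    (hasDerivAt_iff_tendsto_slope.1 hf).mono_left
      (nhdsWithin_mono x fun s hs => ne_of_gt hs)
  refine le_of_tendsto hslope ?_
  filter_upwards [hle, self_mem_nhdsWithin] with s h₁ (h₂ : x < s)
  rw [slope_def_field]
  exact div_nonpos_of_nonpos_of_nonneg (by linarith) (by linarith)

theorem sinh_le_exp {x : ℝ} : sinh x ≤ exp x := by
  rw [sinh_eq]
  linarith [exp_pos x, exp_pos (-x)]

theorem sinh_le_mul_exp (x : ℝ) : sinh x ≤ x * exp x := by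
  have h : (1 - 2 * x) * exp x ≤ exp (-x) := by
    have h₁ : exp (-x) = exp (-2 * x) * exp x := by rw [← exp_add]; ring_nf
    rw [h₁]
    exact mul_le_mul_of_nonneg_right (by linarith [add_one_le_exp (-2 * x)]) (exp_pos x).le
  rw [sinh_eq]
  linarith

theorem cosh_le_exp {x : ℝ} (hx : 0 ≤ x) : cosh x ≤ exp x := by
  rw [cosh_eq]
  linarith [exp_le_exp.2 (show -x ≤ x by linarith)]

/-- The barrier `g(h, t)`: convex in `h ≥ 0`, and caloric up to the linear term. -/
noncomputable def barrier (k B a h t : ℝ) : ℝ := exp (k ^ 2 * (t - a)) * sinh (k * h) - B * h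

/-- The two-point function `g(u(y, t) - u(x, t), t) - N (y - x)`. -/
noncomputable def twoPoint (u : ℝ → ℝ → ℝ) (k B N a x y t : ℝ) : ℝ :=
  barrier k B a (u y t - u x t) t - N * (y - x)

theorem hasDerivAt_barrier {k B a t h' s : ℝ} {h : ℝ → ℝ} (hh : HasDerivAt h h' s) :
    HasDerivAt (fun r => barrier k B a (h r) t)
      ((exp (k ^ 2 * (t - a)) * (k * cosh (k * h s)) - B) * h') s := by
  have := (((hh.const_mul k).sinh).const_mul (exp (k ^ 2 * (t - a)))).sub (hh.const_mul B)
  refine this.congr_deriv ?_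
  ring

theorem hasDerivAt_barrier_time {k B a h' t : ℝ} {h : ℝ → ℝ} (hh : HasDerivAt h h' t) :
    HasDerivAt (fun s => barrier k B a (h s) s)
      (k ^ 2 * exp (k ^ 2 * (t - a)) * sinh (k * h t)
        + (exp (k ^ 2 * (t - a)) * (k * cosh (k * h t)) - B) * h') t := by
  have he : HasDerivAt (fun s => exp (k ^ 2 * (s - a))) (exp (k ^ 2 * (t - a)) * (k ^ 2 * 1)) t :=
    (((hasDerivAt_id t).sub_const a).const_mul (k ^ 2)).exp
  have := (he.mul ((hh.const_mul k).sinh)).sub (hh.const_mul B)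
  refine this.congr_deriv ?_
  ring

/-- The two-point function has no maximum at which `x < y`, `t > a` and `u(x, t) < u(y, t)`. -/
theorem twoPoint_no_interior_max {u : ℝ → ℝ → ℝ} {a b M k B N : ℝ}
    (hx : ∀ t ∈ Ioc a b, ∀ x, HasDerivAt (fun y => u y t) (pderivX u x t) x)
    (hxx : ∀ t ∈ Ioc a b, ∀ x, HasDerivAt (fun y => pderivX u y t) (pderivXX u x t) x)
    (ht : ∀ t ∈ Ioc a b, ∀ x, HasDerivAt (u x) (pderivT u x t) t)
    (heq : ∀ t ∈ Ioc a b, ∀ x, pderivT u x t = pderivXX u x t / (1 + pderivX u x t ^ 2))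
    (hk : 0 < k) (hB : 0 ≤ B) (hBN : B ≤ N) (hN : 0 < N)
    (hkN : k * exp (k ^ 2 * (b - a) + k * M) ≤ N)
    {x y t : ℝ} (hxy : x < y) (hmem : t ∈ Ioc a b) (hpos : u x t < u y t)
    (hM : u y t - u x t ≤ M)
    (hmax : ∀ x' y' t', x' ≤ y' → t' ∈ Icc a b → u x' t' ≤ u y' t' →
      twoPoint u k B N a x' y' t' ≤ twoPoint u k B N a x y t) : False := by
  have hmem' : t ∈ Icc a b := ⟨hmem.1.le, hmem.2⟩
  set E := exp (k ^ 2 * (t - a)) with hE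
  set h := u y t - u x t with hh
  set G := E * (k * cosh (k * h)) - B with hG
  have hEpos : 0 < E := exp_pos _
  have hhpos : 0 < h := sub_pos.2 hpos
  have hcont : Continuous fun z => u z t :=
    continuous_iff_continuousAt.2 fun z => (hx t hmem z).continuousAt
  -- first-order conditions
  have hfy : G * pderivX u y t = N := by
    have hd : HasDerivAt (fun s => twoPoint u k B N a x s t) (G * pderivX u y t - N * 1) y :=
      (hasDerivAt_barrier ((hx t hmem y).sub_const (u x t))).sub
        (((hasDerivAt_id y).sub_const x).const_mul N)
    have hloc : IsLocalMax (fun s => twoPoint u k B N a x s t) y := by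
      filter_upwards [lt_mem_nhds hxy, hcont.continuousAt.eventually_const_lt hpos] with s h₁ h₂
      exact hmax x s t h₁.le hmem' h₂.le
    linarith [hloc.hasDerivAt_eq_zero hd]
  have hfx : G * pderivX u x t = N := by
    have hd : HasDerivAt (fun s => twoPoint u k B N a s y t)
        (G * (-pderivX u x t) - N * (-1)) x :=
      (hasDerivAt_barrier ((hx t hmem x).const_sub (u y t))).sub
        (((hasDerivAt_id x).const_sub y).const_mul N)
    have hloc : IsLocalMax (fun s => twoPoint u k B N a s y t) x := by
      filter_upwards [gt_mem_nhds hxy, hcont.continuousAt.eventually_lt_const hpos] with s h₁ h₂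
      exact hmax s y t h₁.le hmem' h₂.le
    linarith [hloc.hasDerivAt_eq_zero hd]
  have hGne : G ≠ 0 := by
    rintro h0
    rw [h0, zero_mul] at hfy
    exact hN.ne hfy
  have hpp : pderivX u x t = pderivX u y t := mul_left_cancel₀ hGne (hfx.trans hfy.symm)
  set p := pderivX u y t with hp
  set D := pderivXX u y t - pderivXX u x t with hD
  set S := k ^ 2 * E * sinh (k * h) with hS
  have hSpos : 0 < S := by
    have : 0 < sinh (k * h) := sinh_pos_iff.2 (mul_pos hk hhpos)
    positivity
  -- second-order condition along `(x - s, y + s)`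
  have hsecond : 4 * p ^ 2 * S + G * D ≤ 0 := by
    have hp₁ : ∀ s, HasDerivAt (fun s => y + s) 1 s := fun s => (hasDerivAt_id s).const_add y
    have hm₁ : ∀ s, HasDerivAt (fun s => x - s) (-1) s := fun s => (hasDerivAt_id s).const_sub x
    have hH : ∀ s, HasDerivAt (fun s => u (y + s) t - u (x - s) t)
        (pderivX u (y + s) t + pderivX u (x - s) t) s := fun s => by
      have := ((hx t hmem (y + s)).comp s (hp₁ s)).sub ((hx t hmem (x - s)).comp s (hm₁ s))
      refine this.congr_deriv ?_
      ring
    have hP : HasDerivAt (fun s => pderivX u (y + s) t + pderivX u (x - s) t) D 0 := by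
      have h₁ := hxx t hmem (y + 0)
      have h₂ := hxx t hmem (x - 0)
      have := (h₁.comp 0 (hp₁ 0)).add (h₂.comp 0 (hm₁ 0))
      refine this.congr_deriv ?_
      simp only [add_zero, sub_zero, hD]
      ring
    have hf : ∀ s, HasDerivAt (fun s => twoPoint u k B N a (x - s) (y + s) t)
        ((E * (k * cosh (k * (u (y + s) t - u (x - s) t))) - B)
          * (pderivX u (y + s) t + pderivX u (x - s) t) - N * (1 - (-1))) s := fun s =>
      (hasDerivAt_barrier (hH s)).sub (((hp₁ s).sub (hm₁ s)).const_mul N)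
    have hf' := (((((((hH 0).const_mul k).cosh).const_mul k).const_mul E).sub_const B).mul
      hP).sub_const (N * (1 - (-1)))
    have hloc : IsLocalMax (fun s => twoPoint u k B N a (x - s) (y + s) t) 0 := by
      have hc : ContinuousAt (fun s => u (y + s) t - u (x - s) t) 0 := (hH 0).continuousAt
      have h0 : (0 : ℝ) < (fun s => u (y + s) t - u (x - s) t) 0 := by simpa using hpos
      have h1 : ContinuousAt (fun s : ℝ => (y + s) - (x - s)) 0 := by fun_prop
      have h2 : (0 : ℝ) < (fun s : ℝ => (y + s) - (x - s)) 0 := by simpa using hxy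
      filter_upwards [hc.eventually_const_lt h0, h1.eventually_const_lt h2] with s h₁ h₂
      simpa using hmax (x - s) (y + s) t (by linarith) hmem' (by linarith)
    have := second_deriv_nonpos_of_isLocalMax_s1 hf hf' hloc
    simp only [add_zero, sub_zero, hpp, ← hp, ← hh] at this
    calc 4 * p ^ 2 * S + G * D = _ := by rw [hS, hG]; ring
      _ ≤ 0 := this
  -- time derivative
  have htime : 0 ≤ S + G * (D / (1 + p ^ 2)) := by
    have hd := hasDerivAt_barrier_time (k := k) (B := B) (a := a) ((ht t hmem y).sub (ht t hmem x))
    have hd' : HasDerivAt (fun s => twoPoint u k B N a x y s) (S + G * (D / (1 + p ^ 2))) t := by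
      refine (hd.sub_const (N * (y - x))).congr_deriv ?_
      simp only [Pi.sub_apply, heq t hmem, hpp, ← hp, ← hh, ← hE, hS, hG, hD]
      ring
    refine deriv_nonneg_of_eventually_le_left hd' ?_
    have hc : ∀ᶠ s in 𝓝[<] t, 0 < u y s - u x s :=
      nhdsWithin_le_nhds
        (((ht t hmem y).sub (ht t hmem x)).continuousAt.eventually_const_lt hhpos)
    filter_upwards [hc, self_mem_nhdsWithin, nhdsWithin_le_nhds (lt_mem_nhds hmem.1)]
      with s h₁ (h₂ : s < t) h₃
    exact hmax x y s hxy.le ⟨h₃.le, h₂.le.trans hmem.2⟩ (by linarith)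
  -- the slope of the barrier is at most `N`
  have hGN : G ^ 2 ≤ N ^ 2 := by
    refine sq_le_sq' ?_ ?_
    · have : 0 ≤ E * (k * cosh (k * h)) := by
        have := cosh_pos (k * h)
        positivity
      linarith
    · have h₁ : cosh (k * h) ≤ exp (k * M) :=
        (cosh_le_exp (by positivity)).trans (exp_le_exp.2 (by gcongr))
      have h₂ : E ≤ exp (k ^ 2 * (b - a)) := by
        rw [hE]
        have := hmem.2
        gcongr
      have h₃ : E * (k * cosh (k * h)) ≤ exp (k ^ 2 * (b - a)) * (k * exp (k * M)) := by
        gcongr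
      rw [exp_add] at hkN
      linarith
  have hp1 : 1 ≤ p ^ 2 := by
    by_contra! hlt
    have : (G * p) ^ 2 < N ^ 2 := by
      rw [mul_pow]
      have hG2 : 0 < G ^ 2 := by positivity
      nlinarith
    rw [hfy] at this
    exact lt_irrefl _ this
  have hkey : 0 ≤ S * (1 + p ^ 2) + G * D := by
    have h1 : 0 < 1 + p ^ 2 := by positivity
    have : S * (1 + p ^ 2) + G * D = (S + G * (D / (1 + p ^ 2))) * (1 + p ^ 2) := by
      field_simp
    rw [this]
    positivity
  nlinarith

/-- The two-point function is nonpositive wherever `x ≤ y` and `u(x, t) ≤ u(y, t)`. -/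
theorem twoPoint_nonpos {u : ℝ → ℝ → ℝ} {L a b M k B N : ℝ} (hL : 0 < L)
    (hcont : ContinuousOn (fun p : ℝ × ℝ => u p.1 p.2) (univ ×ˢ Icc a b))
    (hx : ∀ t ∈ Ioc a b, ∀ x, HasDerivAt (fun y => u y t) (pderivX u x t) x)
    (hxx : ∀ t ∈ Ioc a b, ∀ x, HasDerivAt (fun y => pderivX u y t) (pderivXX u x t) x)
    (ht : ∀ t ∈ Ioc a b, ∀ x, HasDerivAt (u x) (pderivT u x t) t)
    (heq : ∀ t ∈ Ioc a b, ∀ x, pderivT u x t = pderivXX u x t / (1 + pderivX u x t ^ 2))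
    (hper : ∀ x t, u (x + L) t = u x t)
    (hosc : ∀ x y, ∀ t ∈ Icc a b, u y t - u x t ≤ M)
    (hk : 0 < k) (hBN : B ≤ N) (hkB : k * exp (k * M) ≤ B)
    (hkN : k * exp (k ^ 2 * (b - a) + k * M) ≤ N)
    {x y t : ℝ} (hxy : x ≤ y) (hmem : t ∈ Icc a b) (hle : u x t ≤ u y t) :
    twoPoint u k B N a x y t ≤ 0 := by
  by_contra! hpos
  have hB : 0 < B := lt_of_lt_of_le (by positivity) hkB
  have hN : 0 < N := hB.trans_le hBN
  let F : ℝ → ℝ → ℝ → ℝ := fun x z t =>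
    barrier k B a (max (u (x + z) t - u x t) 0) t - N * z
  have hF : ∀ {x y t}, u x t ≤ u y t → F x (y - x) t = twoPoint u k B N a x y t := by
    intro x y t h
    simp only [F, twoPoint, add_sub_cancel, max_eq_left (sub_nonneg.2 h)]
  have hFper : Function.Periodic F L := fun x => by
    funext z t
    simp only [F, show x + L + z = x + z + L by ring, hper]
  have hFcont : ContinuousOn (fun q : ℝ × ℝ × ℝ => F q.1 q.2.1 q.2.2)
      (Icc 0 L ×ˢ Icc 0 (1 / k) ×ˢ Icc a b) := by
    have h₁ : ContinuousOn (fun q : ℝ × ℝ × ℝ => u (q.1 + q.2.1) q.2.2)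
        (Icc 0 L ×ˢ Icc 0 (1 / k) ×ˢ Icc a b) :=
      hcont.comp (f := fun q : ℝ × ℝ × ℝ => (q.1 + q.2.1, q.2.2))
        (by fun_prop) fun q hq => ⟨mem_univ _, hq.2.2⟩
    have h₂ : ContinuousOn (fun q : ℝ × ℝ × ℝ => u q.1 q.2.2)
        (Icc 0 L ×ˢ Icc 0 (1 / k) ×ˢ Icc a b) :=
      hcont.comp (f := fun q : ℝ × ℝ × ℝ => (q.1, q.2.2))
        (by fun_prop) fun q hq => ⟨mem_univ _, hq.2.2⟩
    have h₃ := (h₁.sub h₂).sup (continuousOn_const (c := (0 : ℝ)))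
    have h₄ : ContinuousOn (fun q : ℝ × ℝ × ℝ => sinh (k * max (u (q.1 + q.2.1) q.2.2
        - u q.1 q.2.2) 0)) (Icc 0 L ×ˢ Icc 0 (1 / k) ×ˢ Icc a b) :=
      continuous_sinh.comp_continuousOn (continuousOn_const.mul h₃)
    have h₅ : ContinuousOn (fun q : ℝ × ℝ × ℝ => exp (k ^ 2 * (q.2.2 - a)))
        (Icc 0 L ×ˢ Icc 0 (1 / k) ×ˢ Icc a b) := by fun_prop
    have h₆ : ContinuousOn (fun q : ℝ × ℝ × ℝ => N * q.2.1)
        (Icc 0 L ×ˢ Icc 0 (1 / k) ×ˢ Icc a b) := by fun_prop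
    exact ((h₅.mul h₄).sub (continuousOn_const.mul h₃)).sub h₆
  have hcompact : IsCompact (Icc 0 L ×ˢ Icc 0 (1 / k) ×ˢ Icc a b) :=
    isCompact_Icc.prod (isCompact_Icc.prod isCompact_Icc)
  obtain ⟨⟨x₀, z₀, t₀⟩, ⟨-, hz₀, ht₀⟩, hmax₀⟩ := hcompact.exists_isMaxOn
    ⟨(0, 0, t), ⟨le_rfl, hL.le⟩, ⟨le_rfl, by positivity⟩, hmem⟩ hFcont
  have hfar : ∀ x' z' t', 1 / k < z' → t' ∈ Icc a b → F x' z' t' ≤ 0 := by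
    intro x' z' t' hz ht'
    have hM : 0 ≤ M := by simpa using hosc 0 0 t' ht'
    set h := max (u (x' + z') t' - u x' t') 0
    have h0 : 0 ≤ h := le_max_right _ _
    have h1 : h ≤ M := max_le (hosc _ _ _ ht') hM
    have h2 : sinh (k * h) ≤ exp (k * M) :=
      sinh_le_exp.trans (exp_le_exp.2 (by gcongr))
    have h3 : exp (k ^ 2 * (t' - a)) * sinh (k * h) ≤ exp (k ^ 2 * (b - a)) * exp (k * M) := by
      have := ht'.2
      have : 0 ≤ sinh (k * h) := sinh_nonneg_iff.2 (by positivity)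
      gcongr
    have h4 : exp (k ^ 2 * (b - a)) * exp (k * M) ≤ N * (1 / k) := by
      rw [← exp_add, mul_one_div, le_div_iff₀ hk]
      linarith
    have h5 : N * (1 / k) ≤ N * z' := by gcongr
    have h6 : 0 ≤ B * h := by positivity
    change exp (k ^ 2 * (t' - a)) * sinh (k * h) - B * h - N * z' ≤ 0
    linarith
  have hglobal : ∀ x' z' t', 0 ≤ z' → t' ∈ Icc a b → 0 < F x' z' t' →
      F x' z' t' ≤ F x₀ z₀ t₀ := by
    intro x' z' t' hz ht' hF'
    obtain ⟨x'', hx'', hFx⟩ := hFper.exists_mem_Ico₀ hL x'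
    rw [hFx]
    refine hmax₀ (a := (x'', z', t')) ⟨⟨hx''.1, hx''.2.le⟩, ⟨hz, ?_⟩, ht'⟩
    by_contra! hz'
    exact hF'.not_ge (hfar x' z' t' hz' ht')
  have hm : 0 < F x₀ z₀ t₀ := by
    rw [← hF hle] at hpos
    exact hpos.trans_le (hglobal x (y - x) t (sub_nonneg.2 hxy) hmem hpos)
  have hinc : u x₀ t₀ < u (x₀ + z₀) t₀ := by
    by_contra! h
    have : F x₀ z₀ t₀ = -(N * z₀) := by
      simp [F, max_eq_right (sub_nonpos.2 h), barrier]
    nlinarith [hz₀.1]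
  have hz₀' : 0 < z₀ := by
    refine hz₀.1.lt_of_ne ?_
    rintro rfl
    simp at hinc
  have ht₀' : a < t₀ := by
    refine ht₀.1.lt_of_ne ?_
    rintro rfl
    set h := u (x₀ + z₀) a - u x₀ a with hh
    have h0 : 0 < h := sub_pos.2 hinc
    have h1 : h ≤ M := hosc _ _ _ ht₀
    have h2 : F x₀ z₀ a = sinh (k * h) - B * h - N * z₀ := by
      simp [F, ← hh, max_eq_left h0.le, barrier]
    have h3 : k * h * exp (k * h) ≤ B * h := by
      calc k * h * exp (k * h) ≤ k * h * exp (k * M) := by gcongr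
        _ = k * exp (k * M) * h := by ring
        _ ≤ B * h := by gcongr
    have := sinh_le_mul_exp (k * h)
    nlinarith [mul_pos hN hz₀']
  have hval : F x₀ z₀ t₀ = twoPoint u k B N a x₀ (x₀ + z₀) t₀ := by
    rw [← hF hinc.le, add_sub_cancel_left]
  refine twoPoint_no_interior_max hx hxx ht heq hk hB.le hBN hN hkN
    (show x₀ < x₀ + z₀ by linarith) ⟨ht₀', ht₀.2⟩ hinc (hosc _ _ _ ht₀) ?_
  intro x' y' t' hxy' ht' hle'
  rw [← hval, ← hF hle']
  by_cases hF' : 0 < F x' (y' - x') t'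
  · exact hglobal _ _ _ (sub_nonneg.2 hxy') ht' hF'
  · exact (not_lt.1 hF').trans hm.le

/-- One-sided gradient bound after a time `b - a ≤ 1`. -/
theorem pderivX_le_exp {u : ℝ → ℝ → ℝ} {L a b M : ℝ} (hL : 0 < L) (hM : 0 < M)
    (hab : a < b) (hab' : b - a ≤ 1)
    (hcont : ContinuousOn (fun p : ℝ × ℝ => u p.1 p.2) (univ ×ˢ Icc a b))
    (hx : ∀ t ∈ Ioc a b, ∀ x, HasDerivAt (fun y => u y t) (pderivX u x t) x)
    (hxx : ∀ t ∈ Ioc a b, ∀ x, HasDerivAt (fun y => pderivX u y t) (pderivXX u x t) x)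
    (ht : ∀ t ∈ Ioc a b, ∀ x, HasDerivAt (u x) (pderivT u x t) t)
    (heq : ∀ t ∈ Ioc a b, ∀ x, pderivT u x t = pderivXX u x t / (1 + pderivX u x t ^ 2))
    (hper : ∀ x t, u (x + L) t = u x t)
    (hosc : ∀ x y, ∀ t ∈ Icc a b, u y t - u x t ≤ M) (x : ℝ) :
    pderivX u x b ≤ exp ((M + 1) ^ 2 / (b - a)) := by
  set p := pderivX u x b with hp
  rcases le_or_gt p 0 with hp0 | hp0
  · exact hp0.trans (exp_pos _).le
  have hτ : 0 < b - a := sub_pos.2 hab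
  have hbmem : b ∈ Ioc a b := ⟨hab, le_rfl⟩
  set k := (M + 1) / (b - a) with hk
  have hk1 : 1 ≤ k := by
    rw [hk, le_div_iff₀ hτ]
    linarith
  have hkpos : 0 < k := by linarith
  have hkτ : k * (b - a) = M + 1 := by rw [hk]; field_simp
  have hkk : k ^ 2 * (b - a) = k * (M + 1) := by rw [sq, mul_assoc, hkτ]
  set B := k * exp (k * M) with hB
  set N := k * exp (k * (M + 1) + k * M) with hN
  have hBN : B ≤ N := by
    rw [hB, hN]
    gcongr
    have : 0 < k * (M + 1) := by positivity
    linarith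
  have htp : ∀ y, x ≤ y → u x b ≤ u y b → twoPoint u k B N a x y b ≤ 0 := fun y h₁ h₂ =>
    twoPoint_nonpos hL hcont hx hxx ht heq hper hosc hkpos hBN le_rfl (by rw [hkk]) h₁
      ⟨hab.le, le_rfl⟩ h₂
  have hd : HasDerivAt (fun y => twoPoint u k B N a x y b)
      ((exp (k ^ 2 * (b - a)) * (k * cosh (k * (u x b - u x b))) - B) * p - N * 1) x :=
    (hasDerivAt_barrier ((hx b hbmem x).sub_const (u x b))).sub (((hasDerivAt_id x).sub_const x).const_mul N)
  have hinc : ∀ᶠ y in 𝓝[>] x, u x b < u y b := by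
    have hslope : Tendsto (slope (fun y => u y b) x) (𝓝[>] x) (𝓝 p) :=
      (hasDerivAt_iff_tendsto_slope.1 (hx b hbmem x)).mono_left
        (nhdsWithin_mono x fun s hs => ne_of_gt hs)
    filter_upwards [hslope.eventually_const_lt hp0, self_mem_nhdsWithin] with y h₁ (h₂ : x < y)
    rw [slope_def_field, lt_div_iff₀ (sub_pos.2 h₂)] at h₁
    linarith
  have hle := deriv_nonpos_of_eventually_le_right hd (by
    filter_upwards [hinc, self_mem_nhdsWithin] with y h₁ (h₂ : x < y)
    have h0 : twoPoint u k B N a x x b = 0 := by simp [twoPoint, barrier]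
    rw [h0]
    exact htp y h₂.le h₁.le)
  have hexp : 2 ≤ exp k := by linarith [add_one_le_exp k]
  have hgoal : (M + 1) ^ 2 / (b - a) = k * (M + 1) := by rw [hk]; ring
  rw [hgoal]
  rw [hkk, sub_self, mul_zero, cosh_zero, hB, hN, exp_add,
    show k * (M + 1) = k * M + k by ring, exp_add] at hle
  rw [show k * (M + 1) = k * M + k by ring, exp_add]
  set e := exp (k * M)
  have he : 0 < e := exp_pos _
  have hle' : (exp k - 1) * p ≤ e * exp k := by
    have : k * e * ((exp k - 1) * p - e * exp k) ≤ 0 := by linarith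
    by_contra! hlt
    have : 0 < k * e * ((exp k - 1) * p - e * exp k) := mul_pos (by positivity) (by linarith)
    linarith
  nlinarith

theorem gradient_bound_curve_shortening :
    ∀ M : ℝ, 0 < M → ∃ C₁ C₂ : ℝ,
      ∀ (L T : ℝ) (u : ℝ → ℝ → ℝ), 0 < L → 0 < T →
        ContDiffOn ℝ (⊤ : ℕ∞) (fun p : ℝ × ℝ => u p.1 p.2) (univ ×ˢ Ico 0 T) →
        (∀ x : ℝ, ∀ t ∈ Ico (0:ℝ) T,
          pderivT u x t = pderivXX u x t / (1 + (pderivX u x t)^2)) →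
        (∀ x t : ℝ, u (x + L) t = u x t) →
        (∀ x y : ℝ, ∀ t ∈ Ico (0:ℝ) T, u y t - u x t ≤ M) →
        ∀ x t : ℝ, 0 < t → t < T →
          |pderivX u x t| ≤ C₁ * (1 + t ^ ((3:ℝ)/2) * Real.exp (C₂ / t)) := by
  intro M hM
  set A := (M + 1) ^ 2 with hA
  have hApos : 0 < A := by positivity
  refine ⟨exp A, A + 2, ?_⟩
  intro L T u hL hT hu heq hper hosc x t ht0 htT
  have hat : ∀ x, ∀ s ∈ Ioo 0 T, ContDiffAt ℝ 2 (fun p : ℝ × ℝ => u p.1 p.2) (x, s) := by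
    intro x s hs
    have h := hu.contDiffAt (x := (x, s)) (prod_mem_nhds univ_mem (Ico_mem_nhds hs.1 hs.2))
    exact h.of_le (WithTop.coe_le_coe.2 le_top)
  have hspace : ∀ s ∈ Ioo 0 T, ContDiff ℝ 2 (fun y => u y s) := fun s hs =>
    contDiff_iff_contDiffAt.2 fun y =>
      (hat y s hs).comp (f := fun y => (y, s)) y (by fun_prop)
  have hdx : ∀ s ∈ Ioo 0 T, ∀ y, HasDerivAt (fun z => u z s) (pderivX u y s) y := fun s hs y =>
    ((hspace s hs).differentiable (by norm_num) y).hasDerivAt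
  have hdxx : ∀ s ∈ Ioo 0 T, ∀ y,
      HasDerivAt (fun z => pderivX u z s) (pderivXX u y s) y := fun s hs y =>
    ((((contDiff_succ_iff_deriv (n := 1)).1 (hspace s hs)).2.2).differentiable
      (by norm_num) y).hasDerivAt
  have hdt : ∀ s ∈ Ioo 0 T, ∀ y, HasDerivAt (u y) (pderivT u y s) s := fun s hs y => by
    have h : ContDiffAt ℝ 2 (fun r => u y r) s :=
      (hat y s hs).comp (f := fun r => (y, r)) s (by fun_prop)
    exact (h.differentiableAt (by norm_num)).hasDerivAt
  set τ := min t 1 with hτ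
  have hτ0 : 0 < τ := lt_min ht0 one_pos
  have hτt : τ ≤ t := min_le_left _ _
  have hIoc : ∀ s ∈ Ioc (t - τ) t, s ∈ Ioo 0 T := fun s hs =>
    ⟨by linarith [hs.1], hs.2.trans_lt htT⟩
  have hIcc : ∀ s ∈ Icc (t - τ) t, s ∈ Ico 0 T := fun s hs =>
    ⟨by linarith [hs.1], hs.2.trans_lt htT⟩
  have hcont : ContinuousOn (fun p : ℝ × ℝ => u p.1 p.2) (univ ×ˢ Icc (t - τ) t) :=
    hu.continuousOn.mono (prod_mono_right hIcc)
  have hbound : |pderivX u x t| ≤ exp (A / τ) := by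
    have hlen : t - (t - τ) = τ := by ring
    refine abs_le'.2 ⟨?_, ?_⟩
    · have := pderivX_le_exp (u := u) hL hM (by linarith : t - τ < t)
        (hlen.trans_le (min_le_right _ _)) hcont
        (fun s hs => hdx s (hIoc s hs)) (fun s hs => hdxx s (hIoc s hs))
        (fun s hs => hdt s (hIoc s hs))
        (fun s hs y => heq y s ⟨(hIoc s hs).1.le, (hIoc s hs).2⟩) hper
        (fun y z s hs => hosc y z s (hIcc s hs)) x
      rwa [hlen] at this
    · let v : ℝ → ℝ → ℝ := fun y s => -u y s
      have hvx : ∀ y s, pderivX v y s = -pderivX u y s := fun y s => by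
        simp only [pderivX, v, deriv.fun_neg]
      have hvxx : ∀ y s, pderivXX v y s = -pderivXX u y s := fun y s => by
        simp only [pderivXX, hvx, deriv.fun_neg]
      have hvt : ∀ y s, pderivT v y s = -pderivT u y s := fun y s => by
        simp only [pderivT, v, deriv.fun_neg]
      have := pderivX_le_exp (u := v) hL hM (by linarith : t - τ < t)
        (hlen.trans_le (min_le_right _ _)) hcont.neg
        (fun s hs y => by rw [hvx]; exact (hdx s (hIoc s hs) y).neg)
        (fun s hs y => by simp only [hvx, hvxx]; exact (hdxx s (hIoc s hs) y).neg)
        (fun s hs y => by rw [hvt]; exact (hdt s (hIoc s hs) y).neg)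
        (fun s hs y => by
          rw [hvt, hvxx, hvx, heq y s ⟨(hIoc s hs).1.le, (hIoc s hs).2⟩]
          ring)
        (fun y s => by simp only [v, hper])
        (fun y z s hs => by linarith [hosc z y s (hIcc s hs)]) x
      rwa [hlen, hvx] at this
  refine hbound.trans ?_
  rcases le_total 1 t with h1 | h1
  · rw [hτ, min_eq_right h1, div_one]
    have : 0 ≤ t ^ ((3:ℝ)/2) * exp ((A + 2) / t) := by positivity
    nlinarith [exp_pos A]
  · rw [hτ, min_eq_left h1]
    have h2 : t ^ 2 ≤ t ^ ((3:ℝ)/2) := by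
      rw [← rpow_natCast]
      exact rpow_le_rpow_of_exponent_ge ht0 h1 (by norm_num)
    have h3 : 1 ≤ t * exp (1 / t) := by
      have := add_one_le_exp (1 / t)
      calc (1 : ℝ) = t * (1 / t) := by field_simp
        _ ≤ t * exp (1 / t) := by gcongr; linarith
    have h4 : exp ((A + 2) / t) = exp (A / t) * exp (1 / t) ^ 2 := by
      rw [sq, ← exp_add, ← exp_add]
      congr 1
      ring
    have h5 : exp (A / t) ≤ t ^ ((3:ℝ)/2) * exp ((A + 2) / t) := by
      calc exp (A / t) = exp (A / t) * 1 ^ 2 := by ring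
        _ ≤ exp (A / t) * (t * exp (1 / t)) ^ 2 := by gcongr
        _ = t ^ 2 * exp ((A + 2) / t) := by rw [h4]; ring
        _ ≤ _ := by gcongr
    have h6 : 1 ≤ exp A := one_le_exp hApos.le
    nlinarith [exp_pos (A / t)]
end

section
/- Let α : ℝ → ℝ be continuous and positive and let L > 0. Let u be a regular L-periodic solution of ∂_t u = α(∂_x u) ∂²_x u on ℝ × [0,T], and let ψ ∈ C(0,L/2) be positive and a modulus of continuity for u(·,0). Let φ ∈ S_ψ. Then φ(·,t) is a modulus of continuity for u(·,t) for each t ∈ (0,T]. -/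
open Set Real Filter

/-- `ψ` is a modulus of continuity for the `L`-periodic function `u`. -/
def IsModulus (L : ℝ) (ψ : ℝ → ℝ) (u : ℝ → ℝ) : Prop :=
  ∀ x y : ℝ, 0 < y - x → y - x < L →
    -(2 * ψ ((L + x - y) / 2)) ≤ u y - u x ∧ u y - u x ≤ 2 * ψ ((y - x) / 2)


/-- Membership in the class `S_ψ` of supersolutions of `∂ₜφ = α(φ')φ''` on
`[0, L/2] × [0, T]` lying above `ψ` at time `0`. -/
def MemS (α : ℝ → ℝ) (L T : ℝ) (ψ : ℝ → ℝ) (φ : ℝ → ℝ → ℝ) : Prop :=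
  (∀ z t : ℝ, z ∈ Icc 0 (L/2) → t ∈ Icc 0 T → 0 ≤ φ z t) ∧
  ContinuousOn (fun p : ℝ × ℝ => φ p.1 p.2)
    ((Icc 0 (L/2) ×ˢ Icc 0 T) \ {((0:ℝ), (0:ℝ)), ((L/2 : ℝ), (0:ℝ))}) ∧
  RegularOn φ (Ioo 0 (L/2) ×ˢ Ioc 0 T) ∧
  (∀ z t : ℝ, z ∈ Ioo 0 (L/2) → t ∈ Ioc 0 T →
    α (pderivX φ z t) * pderivXX φ z t ≤ pderivT φ z t) ∧
  (∀ z ∈ Ioo (0:ℝ) (L/2), ψ z ≤ φ z 0)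

/-- Necessary second order condition at a local maximum. -/
lemma IsLocalMax.deriv_deriv_nonpos {f : ℝ → ℝ} {x : ℝ} (h : IsLocalMax f x)
    (hf : ContinuousAt f x) : deriv (deriv f) x ≤ 0 := by
  by_contra! hpos
  have hmin : IsLocalMin f x := isLocalMin_of_deriv_deriv_pos hpos h.deriv_eq_zero hf
  have hconst : f =ᶠ[nhds x] fun _ => f x := by
    filter_upwards [h, hmin] with y h₁ h₂ using le_antisymm h₁ h₂
  have hzero : deriv (deriv f) x = 0 := by
    rw [hconst.deriv.deriv_eq]
    simp
  linarith

/-- The derivative is nonnegative at a point where the function rises to its value from below. -/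
lemma HasDerivAt.nonneg_of_eventually_le_left {f : ℝ → ℝ} {f' x : ℝ} (h : HasDerivAt f f' x)
    (hle : ∀ᶠ y in nhdsWithin x (Iio x), f y ≤ f x) : 0 ≤ f' := by
  have hlim := hasDerivWithinAt_iff_tendsto_slope' (by simp) |>.1 (h.hasDerivWithinAt (s := Iio x))
  refine ge_of_tendsto hlim ?_
  filter_upwards [hle, self_mem_nhdsWithin] with y hy hlt
  rw [slope_def_field]
  exact div_nonneg_of_nonpos (by linarith) (by linarith [mem_Iio.1 hlt])

/-- Over a compact time-slab, the superlevel set of a function which is upper semicontinuous at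
its negative points has a first time. -/
lemma exists_first_time {X : Type*} [TopologicalSpace X] {K : Set (X × ℝ)} (hK : IsCompact K)
    (hKc : IsClosed K) {W : X × ℝ → ℝ}
    (husc : ∀ p ∈ K, W p < 0 → ∀ᶠ q in nhdsWithin p K, W q < 0)
    (hne : ∃ p ∈ K, 0 ≤ W p) :
    ∃ p ∈ K, 0 ≤ W p ∧ ∀ q ∈ K, q.2 < p.2 → W q < 0 := by
  have hcl : IsClosed {p ∈ K | 0 ≤ W p} := by
    refine isClosed_of_closure_subset fun p hp => ?_
    have hpK : p ∈ K := closure_minimal (fun q hq => hq.1) hKc hp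
    refine ⟨hpK, ?_⟩
    by_contra! hneg
    obtain ⟨q, hq, hq'⟩ :=
      ((mem_closure_iff_frequently.1 hp).and_eventually
        (eventually_nhdsWithin_iff.1 (husc p hpK hneg))).exists
    linarith [hq.2, hq' hq.1]
  have hcomp : IsCompact {p ∈ K | 0 ≤ W p} := hK.of_isClosed_subset hcl fun q hq => hq.1
  obtain ⟨p, hp, hmin⟩ := hcomp.exists_isMinOn hne continuous_snd.continuousOn
  refine ⟨p, hp.1, hp.2, fun q hq hlt => ?_⟩
  by_contra! hge
  exact absurd (hmin ⟨hq, hge⟩) (not_le.2 hlt)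

/-- The excess of the oscillation of `u` about the midpoint `m` over twice `φ`, lowered by the
time-dependent penalty `ε * (1 + t)`. -/
def penalizedExcess (u φ : ℝ → ℝ → ℝ) (ε m z t : ℝ) : ℝ :=
  u (m + z) t - u (m - z) t - 2 * φ z t - ε * (1 + t)

section Maximum

variable {α : ℝ → ℝ} {L T : ℝ} {u φ : ℝ → ℝ → ℝ} {ε m z t : ℝ}

/-- The penalized excess cannot reach a nonnegative interior spatial maximum for the first
time. -/
lemma not_first_interior_max (hα : ∀ p, 0 < α p) (hε : 0 < ε)
    (hu_reg : RegularOn u (univ ×ˢ Icc 0 T))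
    (hu_eq : ∀ x : ℝ, ∀ t ∈ Icc (0:ℝ) T,
      pderivT u x t = α (pderivX u x t) * pderivXX u x t)
    (hφ_reg : RegularOn φ (Ioo 0 (L/2) ×ˢ Ioc 0 T))
    (hφ_eq : ∀ z t : ℝ, z ∈ Ioo 0 (L/2) → t ∈ Ioc 0 T →
      α (pderivX φ z t) * pderivXX φ z t ≤ pderivT φ z t)
    (hz : z ∈ Ioo 0 (L/2)) (ht : t ∈ Ioc 0 T) (h0 : 0 ≤ penalizedExcess u φ ε m z t)
    (hlt : ∀ m', ∀ z' ∈ Ioo 0 (L/2), ∀ s ∈ Ico 0 t, penalizedExcess u φ ε m' z' s < 0) :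
    False := by
  obtain ⟨-, hux, huxx, hut, -⟩ := hu_reg
  obtain ⟨-, hφx, hφxx, hφt, -⟩ := hφ_reg
  have htI : t ∈ Icc 0 T := Ioc_subset_Icc_self ht
  have hux' (x : ℝ) : HasDerivAt (fun y => u y t) (pderivX u x t) x :=
    (hux (x, t) ⟨mem_univ _, htI⟩).hasDerivAt
  have huxx' (x : ℝ) : HasDerivAt (fun y => pderivX u y t) (pderivXX u x t) x :=
    (huxx (x, t) ⟨mem_univ _, htI⟩).hasDerivAt
  have hut' (x : ℝ) : HasDerivAt (fun s => u x s) (pderivT u x t) t :=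
    (hut (x, t) ⟨mem_univ _, htI⟩).hasDerivAt
  have hφx' {w : ℝ} (hw : w ∈ Ioo 0 (L/2)) : HasDerivAt (fun y => φ y t) (pderivX φ w t) w :=
    (hφx (w, t) ⟨hw, ht⟩).hasDerivAt
  have hφxx' : HasDerivAt (fun y => pderivX φ y t) (pderivXX φ z t) z :=
    (hφxx (z, t) ⟨hz, ht⟩).hasDerivAt
  have hφt' {w : ℝ} (hw : w ∈ Ioo 0 (L/2)) : HasDerivAt (fun s => φ w s) (pderivT φ w t) t :=
    (hφt (w, t) ⟨hw, ht⟩).hasDerivAt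
  have htime (m' : ℝ) {w : ℝ} (hw : w ∈ Ioo 0 (L/2)) :
      HasDerivAt (fun s => penalizedExcess u φ ε m' w s)
        (pderivT u (m' + w) t - pderivT u (m' - w) t - 2 * pderivT φ w t - ε * 1) t :=
    (((hut' _).sub (hut' _)).sub ((hφt' hw).const_mul 2)).sub
      (((hasDerivAt_id t).const_add 1).const_mul ε)
  have hleft (m' : ℝ) {w : ℝ} (hw : w ∈ Ioo 0 (L/2)) :
      ∀ᶠ s in nhdsWithin t (Iio t), penalizedExcess u φ ε m' w s < 0 := by
    filter_upwards [Ico_mem_nhdsLT ht.1] with s hs using hlt m' w hw s hs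
  have hle (m' : ℝ) {w : ℝ} (hw : w ∈ Ioo 0 (L/2)) : penalizedExcess u φ ε m' w t ≤ 0 :=
    le_of_tendsto ((htime m' hw).continuousAt.tendsto.mono_left nhdsWithin_le_nhds)
      ((hleft m' hw).mono fun _ h => h.le)
  have hIoo : ∀ᶠ w in nhds z, w ∈ Ioo 0 (L/2) := isOpen_Ioo.mem_nhds hz
  have hmax_m : IsLocalMax (fun m' => penalizedExcess u φ ε m' z t) m :=
    Eventually.of_forall fun m' => (hle m' hz).trans h0
  have hmax_z : IsLocalMax (fun w => penalizedExcess u φ ε m w t) z :=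
    hIoo.mono fun w hw => (hle m hw).trans h0
  have hderiv_m : HasDerivAt (fun m' => penalizedExcess u φ ε m' z t)
      (pderivX u (m + z) t - pderivX u (m - z) t) m :=
    ((((hux' _).comp_add_const m z).sub ((hux' _).comp_sub_const m z)).sub_const _).sub_const _
  have hderiv_z {w : ℝ} (hw : w ∈ Ioo 0 (L/2)) :
      HasDerivAt (fun w => penalizedExcess u φ ε m w t)
        (pderivX u (m + w) t - -pderivX u (m - w) t - 2 * pderivX φ w t) w :=
    ((((hux' _).comp_const_add m w).sub ((hux' _).comp_const_sub m w)).sub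
      ((hφx' hw).const_mul 2)).sub_const _
  have hderiv_zz : HasDerivAt (deriv fun w => penalizedExcess u φ ε m w t)
      (pderivXX u (m + z) t - - -pderivXX u (m - z) t - 2 * pderivXX φ z t) z :=
    ((((huxx' _).comp_const_add m z).sub ((huxx' _).comp_const_sub m z).neg).sub
      (hφxx'.const_mul 2)).congr_of_eventuallyEq (hIoo.mono fun w hw => (hderiv_z hw).deriv)
  have h₁ := hmax_m.hasDerivAt_eq_zero hderiv_m
  have h₂ := hmax_z.hasDerivAt_eq_zero (hderiv_z hz)
  have h₃ := hmax_z.deriv_deriv_nonpos (hderiv_z hz).continuousAt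
  rw [hderiv_zz.deriv] at h₃
  have h₄ := (htime m hz).nonneg_of_eventually_le_left
    ((hleft m hz).mono fun _ h => h.le.trans h0)
  have hp : pderivX u (m + z) t = pderivX φ z t := by linarith
  have hq : pderivX u (m - z) t = pderivX φ z t := by linarith
  rw [hu_eq _ t htI, hu_eq _ t htI, hp, hq] at h₄
  have h₅ := hφ_eq z t hz ht
  have h₆ := mul_nonpos_of_nonneg_of_nonpos (hα (pderivX φ z t)).le h₃
  linarith

end Maximum

/-- The penalized excess is negative on the whole parabolic domain. -/
lemma penalizedExcess_neg {α : ℝ → ℝ} (hα : ∀ p, 0 < α p) {L T : ℝ} (hL : 0 < L)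
    {u : ℝ → ℝ → ℝ} (hu_reg : RegularOn u (univ ×ˢ Icc 0 T))
    (hu_eq : ∀ x : ℝ, ∀ t ∈ Icc (0:ℝ) T,
      pderivT u x t = α (pderivX u x t) * pderivXX u x t)
    (hu_per : ∀ x t : ℝ, u (x + L) t = u x t)
    {ψ : ℝ → ℝ} (hψ : IsModulus L ψ (fun x => u x 0))
    {φ : ℝ → ℝ → ℝ} (hφ : MemS α L T ψ φ) {ε : ℝ} (hε : 0 < ε) (m : ℝ) {z t : ℝ}
    (hz : z ∈ Icc 0 (L/2)) (ht : t ∈ Icc 0 T) : penalizedExcess u φ ε m z t < 0 := by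
  obtain ⟨hφ0, hφc, hφ_reg, hφ_eq, hφψ⟩ := hφ
  have hper (m z t : ℝ) : ∃ m' ∈ Icc 0 L,
      penalizedExcess u φ ε m z t = penalizedExcess u φ ε m' z t := by
    have hP : Function.Periodic (fun m => penalizedExcess u φ ε m z t) L := fun m => by
      simp only [penalizedExcess]
      rw [add_right_comm, hu_per, add_sub_right_comm, hu_per]
    obtain ⟨m', hm', h⟩ := hP.exists_mem_Ico₀ hL m
    exact ⟨m', Ico_subset_Icc_self hm', h⟩
  have hdiag (m t : ℝ) {z : ℝ} (hz : z = 0 ∨ z = L/2) : u (m + z) t = u (m - z) t := by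
    rcases hz with rfl | rfl
    · simp
    · rw [← hu_per (m - L/2)]
      congr 1
      ring
  have hpen {t : ℝ} (ht : t ∈ Icc 0 T) : 0 < ε * (1 + t) := mul_pos hε (by linarith [ht.1])
  have hinterior {m z t : ℝ} (hz : z ∈ Icc 0 (L/2)) (ht : t ∈ Icc 0 T)
      (h : 0 ≤ penalizedExcess u φ ε m z t) : z ∈ Ioo 0 (L/2) := by
    by_contra hcon
    have hz' : z = 0 ∨ z = L/2 := by
      by_contra! hne
      exact hcon ⟨lt_of_le_of_ne hz.1 hne.1.symm, lt_of_le_of_ne hz.2 hne.2⟩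
    rw [penalizedExcess, hdiag m t hz'] at h
    linarith [hφ0 z t hz ht, hpen ht]
  let K : Set ((ℝ × ℝ) × ℝ) := (Icc 0 L ×ˢ Icc 0 (L/2)) ×ˢ Icc 0 T
  have hKcomp : IsCompact K := (isCompact_Icc.prod isCompact_Icc).prod isCompact_Icc
  have huc {f : (ℝ × ℝ) × ℝ → ℝ} (hf : Continuous f) :
      ContinuousOn (fun p : (ℝ × ℝ) × ℝ => u (f p) p.2) K :=
    hu_reg.1.comp (f := fun p : (ℝ × ℝ) × ℝ => (f p, p.2))
      (by fun_prop) fun p hp => ⟨mem_univ _, hp.2⟩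
  have hbound : ContinuousOn (fun p : (ℝ × ℝ) × ℝ =>
      u (p.1.1 + p.1.2) p.2 - u (p.1.1 - p.1.2) p.2 - ε * (1 + p.2)) K :=
    ((huc (by fun_prop)).sub (huc (by fun_prop))).sub (by fun_prop)
  by_contra! hcon
  obtain ⟨⟨⟨m₀, z₀⟩, t₀⟩, hp, h0, hfirst⟩ := exists_first_time hKcomp hKcomp.isClosed
    (W := fun p => penalizedExcess u φ ε p.1.1 p.1.2 p.2) (by
      rintro ⟨⟨m, z⟩, t⟩ hp hneg
      by_cases hcorner : (z, t) ∈ ({((0:ℝ), (0:ℝ)), ((L/2 : ℝ), (0:ℝ))} : Set (ℝ × ℝ))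
      · have hz' : z = 0 ∨ z = L/2 := by
          simp only [mem_insert_iff, mem_singleton_iff, Prod.mk.injEq] at hcorner
          exact hcorner.imp And.left And.left
        have hlt : u (m + z) t - u (m - z) t - ε * (1 + t) < 0 := by
          rw [hdiag m t hz']
          linarith [hpen hp.2]
        filter_upwards [(hbound _ hp).eventually_lt_const hlt, self_mem_nhdsWithin] with q hq hqK
        simp only [penalizedExcess]
        linarith [hφ0 q.1.2 q.2 hqK.1.2 hqK.2]
      · have hφat : ContinuousWithinAt (fun p : (ℝ × ℝ) × ℝ => φ p.1.2 p.2) K ((m, z), t) := by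
          have hnhds := (((finite_singleton _).insert _).isClosed.isOpen_compl.mem_nhds hcorner)
          have hφat := (continuousWithinAt_inter hnhds).1 (hφc (z, t) ⟨⟨hp.1.2, hp.2⟩, hcorner⟩)
          exact hφat.comp (f := fun p : (ℝ × ℝ) × ℝ => (p.1.2, p.2)) (x := ((m, z), t)) (s := K)
            (Continuous.continuousWithinAt (by fun_prop)) fun q hq => ⟨hq.1.2, hq.2⟩
        have hW : ContinuousWithinAt
            (fun p : (ℝ × ℝ) × ℝ => penalizedExcess u φ ε p.1.1 p.1.2 p.2) K ((m, z), t) :=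
          ((hbound _ hp).sub (hφat.const_mul 2)).congr_of_eventuallyEq
            (Eventually.of_forall fun q => by simp only [penalizedExcess, Pi.sub_apply]; ring)
            (by simp only [penalizedExcess, Pi.sub_apply]; ring)
        exact hW.eventually_lt_const hneg)
    (by
      obtain ⟨m', hm', h⟩ := hper m z t
      exact ⟨((m', z), t), ⟨⟨hm', hz⟩, ht⟩, h ▸ hcon⟩)
  have hz₀ : z₀ ∈ Ioo 0 (L/2) := hinterior hp.1.2 hp.2 h0
  have ht₀ : t₀ ∈ Icc 0 T := hp.2
  have ht₀pos : 0 < t₀ := by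
    refine lt_of_le_of_ne ht₀.1 fun h => ?_
    subst h
    have hmod := (hψ (m₀ - z₀) (m₀ + z₀) (by linarith [hz₀.1]) (by linarith [hz₀.2])).2
    rw [show (m₀ + z₀ - (m₀ - z₀)) / 2 = z₀ by ring] at hmod
    simp only [penalizedExcess] at h0
    linarith [hφψ z₀ hz₀]
  refine not_first_interior_max hα hε hu_reg hu_eq hφ_reg hφ_eq hz₀ ⟨ht₀pos, ht₀.2⟩ h0
    fun m' z' hz' s hs => ?_
  obtain ⟨m'', hm'', h⟩ := hper m' z' s
  rw [h]
  exact hfirst ((m'', z'), s) ⟨⟨hm'', Ioo_subset_Icc_self hz'⟩, hs.1, hs.2.le.trans ht₀.2⟩ hs.2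

theorem supersolution_gives_modulus
    (α : ℝ → ℝ) (hα : Continuous α) (hαpos : ∀ p, 0 < α p)
    (L T : ℝ) (hL : 0 < L) (hT : 0 < T)
    (u : ℝ → ℝ → ℝ)
    (hu_reg : RegularOn u (univ ×ˢ Icc 0 T))
    (hu_eq : ∀ x : ℝ, ∀ t ∈ Icc (0:ℝ) T,
      pderivT u x t = α (pderivX u x t) * pderivXX u x t)
    (hu_per : ∀ x t : ℝ, u (x + L) t = u x t)
    (ψ : ℝ → ℝ) (hψc : ContinuousOn ψ (Ioo 0 (L/2)))
    (hψpos : ∀ z ∈ Ioo (0:ℝ) (L/2), 0 < ψ z)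
    (hψmod : IsModulus L ψ (fun x => u x 0))
    (φ : ℝ → ℝ → ℝ) (hφ : MemS α L T ψ φ) :
    ∀ t ∈ Ioc (0:ℝ) T, IsModulus L (fun z => φ z t) (fun x => u x t) := by
  have hupper {t : ℝ} (ht : t ∈ Ioc 0 T) (x y : ℝ) (h₁ : 0 < y - x) (h₂ : y - x < L) :
      u y t - u x t ≤ 2 * φ ((y - x) / 2) t := by
    refine le_of_forall_pos_le_add fun δ hδ => ?_
    have ht1 : 0 < 1 + t := by linarith [ht.1]
    have h := penalizedExcess_neg hαpos hL hu_reg hu_eq hu_per hψmod hφ (div_pos hδ ht1)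
      ((x + y) / 2) (z := (y - x) / 2) ⟨by linarith, by linarith⟩ (Ioc_subset_Icc_self ht)
    rw [penalizedExcess, div_mul_cancel₀ _ ht1.ne', show (x + y) / 2 + (y - x) / 2 = y by ring,
      show (x + y) / 2 - (y - x) / 2 = x by ring] at h
    linarith
  intro t ht x y h₁ h₂
  refine ⟨?_, hupper ht x y h₁ h₂⟩
  have h := hupper ht y (x + L) (by linarith) (by linarith)
  rw [hu_per, show x + L - y = L + x - y by ring] at h
  show -(2 * φ ((L + x - y) / 2) t) ≤ u y t - u x t
  linarith
end

section
/- Let α : ℝ → ℝ be continuous and positive, L > 0, and let v be a regular solution of ∂_t v = α(∂_x v) ∂²_x v on [0,L/2] × [0,∞) with boundary values v(0,t) = v(L/2,t) = 0 for all t ≥ 0 and with initial data v(·,0) smooth, nonnegative and concave on [0,L/2] with v(0,0) = v(L/2,0) = 0. Then ∂_t v(z,t) ≤ 0 for all (z,t) ∈ [0,L/2] × [0,∞), and v(·,t) is concave on [0,L/2] for each t ≥ 0. -/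
open Set Real Filter

theorem deriv_deriv_nonpos_of_isLocalMax {f : ℝ → ℝ} {a : ℝ} (h : IsLocalMax f a)
    (hc : ContinuousAt f a) : deriv (deriv f) a ≤ 0 := by
  by_contra! hpos
  have hmin := isLocalMin_of_deriv_deriv_pos hpos h.deriv_eq_zero hc
  have hconst : f =ᶠ[nhds a] fun _ => f a := by
    filter_upwards [h, hmin] with x hx hx'
    exact le_antisymm hx hx'
  have hzero := hconst.deriv.deriv_eq
  simp at hzero
  exact hpos.ne' hzero

theorem le_deriv_of_forall_sub_le {f : ℝ → ℝ} {t ε : ℝ} (ht : 0 < t)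
    (hf : DifferentiableAt ℝ f t)
    (hmax : ∀ s ∈ Icc 0 t, f s - ε * s ≤ f t - ε * t) : ε ≤ deriv f t := by
  have hslope := (hasDerivAt_iff_tendsto_slope.1 hf.hasDerivAt).mono_left
    (nhdsWithin_mono t (fun s (hs : s ∈ Iio t) => ne_of_lt hs))
  refine ge_of_tendsto hslope ?_
  filter_upwards [Ioo_mem_nhdsLT ht] with s hs
  have := hmax s ⟨hs.1.le, hs.2.le⟩
  rw [slope_def_field, le_div_iff_of_neg (by linarith [hs.2])]
  linarith

/-- A weak parabolic maximum principle on a half-infinite strip. -/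
theorem nonpos_of_parabolic_boundary {d : ℝ → ℝ → ℝ} {l : ℝ}
    (hcont : ContinuousOn (fun p : ℝ × ℝ => d p.1 p.2) (Icc 0 l ×ˢ Ici 0))
    (hdiff : ∀ z ∈ Ioo 0 l, ∀ t, 0 < t → DifferentiableAt ℝ (d z) t)
    (hleft : ∀ t, 0 ≤ t → d 0 t ≤ 0) (hright : ∀ t, 0 ≤ t → d l t ≤ 0)
    (hinit : ∀ z ∈ Icc 0 l, d z 0 ≤ 0)
    (hmax : ∀ z ∈ Ioo 0 l, ∀ t, 0 < t → IsLocalMax (fun y => d y t) z → deriv (d z) t ≤ 0) :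
    ∀ z ∈ Icc 0 l, ∀ t, 0 ≤ t → d z t ≤ 0 := by
  intro z₁ hz₁ t₁ ht₁
  by_contra! hpos
  obtain ⟨ε, hε, hεt⟩ : ∃ ε > 0, ε * t₁ < d z₁ t₁ := by
    refine ⟨d z₁ t₁ / (t₁ + 1), by positivity, ?_⟩
    rw [div_mul_eq_mul_div, div_lt_iff₀ (by positivity)]
    nlinarith
  have hcont' : ContinuousOn (fun p : ℝ × ℝ => d p.1 p.2 - ε * p.2) (Icc 0 l ×ˢ Icc 0 t₁) :=
    (hcont.mono (prod_mono_right Icc_subset_Ici_self)).sub (by fun_prop)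
  obtain ⟨⟨z₀, t₀⟩, ⟨hz₀, ht₀⟩, hmax₀⟩ := (isCompact_Icc.prod isCompact_Icc).exists_isMaxOn
    ⟨(z₁, t₁), hz₁, ht₁, le_rfl⟩ hcont'
  have hle : ∀ z ∈ Icc 0 l, ∀ t ∈ Icc 0 t₁, d z t - ε * t ≤ d z₀ t₀ - ε * t₀ :=
    fun z hz t ht => hmax₀ (mk_mem_prod hz ht)
  simp only at hz₀ ht₀
  have hval := hle z₁ hz₁ t₁ ⟨ht₁, le_rfl⟩
  have hεt₀ : 0 ≤ ε * t₀ := mul_nonneg hε.le ht₀.1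
  have hd₀ : 0 < d z₀ t₀ := by linarith
  have htpos : 0 < t₀ := by
    refine lt_of_le_of_ne ht₀.1 ?_
    rintro rfl
    exact (hinit z₀ hz₀).not_gt hd₀
  have hzint : z₀ ∈ Ioo 0 l := by
    refine ⟨lt_of_le_of_ne hz₀.1 ?_, lt_of_le_of_ne hz₀.2 ?_⟩
    · rintro rfl
      exact (hleft t₀ ht₀.1).not_gt hd₀
    · rintro rfl
      exact (hright t₀ ht₀.1).not_gt hd₀
  have hloc : IsLocalMax (fun y => d y t₀) z₀ := by
    filter_upwards [Icc_mem_nhds hzint.1 hzint.2] with y hy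
    linarith [hle y hy t₀ ht₀]
  have hge := le_deriv_of_forall_sub_le htpos (hdiff z₀ hzint t₀ htpos)
    (fun s hs => hle z₀ hz₀ s ⟨hs.1, hs.2.trans ht₀.2⟩)
  linarith [hmax z₀ hzint t₀ htpos hloc]

theorem RegularOn.spatial_derivs_of_isLocalMax_sub {v : ℝ → ℝ → ℝ} {l : ℝ}
    (hreg : RegularOn v (Icc 0 l ×ˢ Ici 0)) {z s t : ℝ} (hz : z ∈ Ioo 0 l)
    (hs : 0 ≤ s) (ht : 0 ≤ t) (hmax : IsLocalMax (fun y => v y s - v y t) z) :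
    pderivX v z s = pderivX v z t ∧ pderivXX v z s ≤ pderivXX v z t := by
  obtain ⟨-, hx, hxx, -⟩ := hreg
  have hderiv : ∀ y ∈ Ioo 0 l,
      deriv (fun y => v y s - v y t) y = pderivX v y s - pderivX v y t := fun y hy =>
    deriv_fun_sub (hx (y, s) ⟨Ioo_subset_Icc_self hy, hs⟩) (hx (y, t) ⟨Ioo_subset_Icc_self hy, ht⟩)
  have hzI := Ioo_subset_Icc_self hz
  have hfirst := hmax.deriv_eq_zero
  rw [hderiv z hz] at hfirst
  have hcont : ContinuousAt (fun y => v y s - v y t) z :=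
    (hx (z, s) ⟨hzI, hs⟩).continuousAt.sub (hx (z, t) ⟨hzI, ht⟩).continuousAt
  have hsecond := deriv_deriv_nonpos_of_isLocalMax hmax hcont
  have heq : deriv (fun y => v y s - v y t) =ᶠ[nhds z]
      fun y => pderivX v y s - pderivX v y t := by
    filter_upwards [Ioo_mem_nhds hz.1 hz.2] with y hy using hderiv y hy
  rw [heq.deriv_eq, deriv_fun_sub (hxx (z, s) ⟨hzI, hs⟩) (hxx (z, t) ⟨hzI, ht⟩)] at hsecond
  exact ⟨sub_eq_zero.1 hfirst, sub_nonpos.1 hsecond⟩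

theorem deriv_nonpos_of_antitoneOn {f : ℝ → ℝ} {s : Set ℝ} {x : ℝ} (hf : AntitoneOn f s)
    (hs : UniqueDiffWithinAt ℝ s x) (hd : DifferentiableAt ℝ f x) : deriv f x ≤ 0 := by
  rw [← hd.derivWithin hs]
  exact hf.derivWithin_nonpos

theorem solution_stays_concave
    (α : ℝ → ℝ) (hα : Continuous α) (hαpos : ∀ p, 0 < α p)
    (L : ℝ) (hL : 0 < L) (v : ℝ → ℝ → ℝ)
    (hreg : RegularOn v (Icc 0 (L/2) ×ˢ Ici 0))
    (heq : ∀ z ∈ Icc (0:ℝ) (L/2), ∀ t ∈ Ici (0:ℝ),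
      pderivT v z t = α (pderivX v z t) * pderivXX v z t)
    (hbdry : ∀ t : ℝ, 0 ≤ t → v 0 t = 0 ∧ v (L/2) t = 0)
    (hinit_smooth : ContDiffOn ℝ (⊤ : ℕ∞) (fun z => v z 0) (Icc 0 (L/2)))
    (hinit_nonneg : ∀ z ∈ Icc (0:ℝ) (L/2), 0 ≤ v z 0)
    (hinit_concave : ConcaveOn ℝ (Icc 0 (L/2)) (fun z => v z 0)) :
    (∀ z ∈ Icc (0:ℝ) (L/2), ∀ t ∈ Ici (0:ℝ), pderivT v z t ≤ 0) ∧
    (∀ t ∈ Ici (0:ℝ), ConcaveOn ℝ (Icc 0 (L/2)) (fun z => v z t)) := by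
  set l := L / 2 with hl
  have hl0 : 0 < l := by positivity
  have hreg' := hreg
  obtain ⟨hc, hx, hxx, ht, -⟩ := hreg'
  have hinitXX : ∀ z ∈ Icc 0 l, pderivXX v z 0 ≤ 0 := fun z hz =>
    deriv_nonpos_of_antitoneOn
      (hinit_concave.antitoneOn_deriv fun y hy => hx (y, 0) ⟨hy, self_mem_Ici⟩)
      (uniqueDiffOn_Icc hl0 z hz) (hxx (z, 0) ⟨hz, self_mem_Ici⟩)
  have hle_init : ∀ z ∈ Icc 0 l, ∀ t, 0 ≤ t → v z t - v z 0 ≤ 0 := by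
    refine nonpos_of_parabolic_boundary (d := fun z t => v z t - v z 0) ?_ ?_ ?_ ?_ ?_ ?_
    · exact hc.sub (hc.comp (f := fun p : ℝ × ℝ => (p.1, (0 : ℝ))) (by fun_prop)
        fun p hp => ⟨hp.1, self_mem_Ici⟩)
    · exact fun z hz t h => (ht (z, t) ⟨Ioo_subset_Icc_self hz, h.le⟩).sub_const _
    · intro t h
      simp [(hbdry t h).1, (hbdry 0 le_rfl).1]
    · intro t h
      simp [(hbdry t h).2, (hbdry 0 le_rfl).2]
    · simp
    · intro z hz t h hmax
      have hzI := Ioo_subset_Icc_self hz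
      have hXX := (hreg.spatial_derivs_of_isLocalMax_sub hz h.le le_rfl hmax).2
      rw [deriv_sub_const]
      change pderivT v z t ≤ 0
      rw [heq z hzI t h.le]
      exact mul_nonpos_of_nonneg_of_nonpos (hαpos _).le (hXX.trans (hinitXX z hzI))
  have hle_shift : ∀ h, 0 ≤ h → ∀ z ∈ Icc 0 l, ∀ t, 0 ≤ t → v z (t + h) - v z t ≤ 0 := by
    intro h hh
    refine nonpos_of_parabolic_boundary (d := fun z t => v z (t + h) - v z t) ?_ ?_ ?_ ?_ ?_ ?_
    · exact (hc.comp (f := fun p : ℝ × ℝ => (p.1, p.2 + h)) (by fun_prop)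
        fun p hp => ⟨hp.1, add_nonneg hp.2 hh⟩).sub hc
    · intro z hz t h0
      have hzI := Ioo_subset_Icc_self hz
      exact (differentiableAt_comp_add_const (f := v z).2
        (ht (z, t + h) ⟨hzI, add_nonneg h0.le hh⟩)).fun_sub (ht (z, t) ⟨hzI, h0.le⟩)
    · intro t h0
      simp [(hbdry t h0).1, (hbdry (t + h) (add_nonneg h0 hh)).1]
    · intro t h0
      simp [(hbdry t h0).2, (hbdry (t + h) (add_nonneg h0 hh)).2]
    · intro z hz
      simpa using hle_init z hz h hh
    · intro z hz t h0 hmax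
      have hzI := Ioo_subset_Icc_self hz
      have hth : 0 ≤ t + h := add_nonneg h0.le hh
      obtain ⟨hX, hXX⟩ := hreg.spatial_derivs_of_isLocalMax_sub hz hth h0.le hmax
      rw [deriv_fun_sub (differentiableAt_comp_add_const (f := v z).2
        (ht (z, t + h) ⟨hzI, hth⟩)) (ht (z, t) ⟨hzI, h0.le⟩), deriv_comp_add_const]
      change pderivT v z (t + h) - pderivT v z t ≤ 0
      rw [heq z hzI _ hth, heq z hzI t h0.le, hX, ← mul_sub]
      exact mul_nonpos_of_nonneg_of_nonpos (hαpos _).le (sub_nonpos.2 hXX)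
  have hT : ∀ z ∈ Icc (0:ℝ) l, ∀ t ∈ Ici (0:ℝ), pderivT v z t ≤ 0 := by
    intro z hz t h0
    refine deriv_nonpos_of_antitoneOn (s := Ici 0) ?_ (uniqueDiffOn_Ici 0 t h0)
      (ht (z, t) ⟨hz, h0⟩)
    intro a ha b _ hab
    have := hle_shift (b - a) (sub_nonneg.2 hab) z hz a ha
    rw [add_sub_cancel] at this
    exact sub_nonpos.1 this
  refine ⟨hT, fun t h0 => ?_⟩
  have hXX : ∀ z ∈ Icc (0:ℝ) l, pderivXX v z t ≤ 0 := by
    intro z hz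
    have := hT z hz t h0
    rw [heq z hz t h0] at this
    exact nonpos_of_mul_nonpos_right this (hαpos _)
  refine concaveOn_of_deriv2_nonpos (convex_Icc 0 l)
    (fun z hz => (hx (z, t) ⟨hz, h0⟩).continuousAt.continuousWithinAt)
    (fun z hz => (hx (z, t) ⟨interior_subset hz, h0⟩).differentiableWithinAt)
    (fun z hz => (hxx (z, t) ⟨interior_subset hz, h0⟩).differentiableWithinAt)
    (fun z hz => hXX z (interior_subset hz))
end

section
/- Let α : ℝ → ℝ be continuous and positive, L > 0, M > 0, and let v be a regular solution of ∂_t v = α(∂_x v) ∂²_x v on [0,L/2] × [0,∞) such that for each t ≥ 0, v(·,t) is concave, satisfies 0 ≤ v(·,t) ≤ M, and v(0,t) = v(L/2,t) = 0, and such that v(z,·) is nonincreasing in t for each z. Then for each δ ∈ (0,L/4), setting C̃_δ = max{M/δ, M/(L/2−δ)} and α_δ = sup{α(p) : |p| ≤ C̃_δ}, one has |v(z,t₂) − v(z,t₁)| ≤ (2 C̃_δ/√π) √(α_δ (t₂ − t₁)) for all z ∈ [δ, L/2 − δ] and all 0 ≤ t₁ ≤ t₂. -/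
open Set Real Filter

/-- The unnormalised error function `∫₀^y exp (-u²) du`. -/
noncomputable def gaussPrimitive (y : ℝ) : ℝ := ∫ u in (0:ℝ)..y, Real.exp (-u ^ 2)

theorem hasDerivAt_gaussPrimitive (y : ℝ) :
    HasDerivAt gaussPrimitive (Real.exp (-y ^ 2)) y := by
  have hc : Continuous fun u : ℝ => Real.exp (-u ^ 2) := by fun_prop
  exact (hc.integral_hasStrictDerivAt 0 y).hasDerivAt

theorem gaussPrimitive_zero : gaussPrimitive 0 = 0 := by simp [gaussPrimitive]

theorem gaussPrimitive_neg (y : ℝ) : gaussPrimitive (-y) = -gaussPrimitive y := by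
  have h := intervalIntegral.integral_comp_neg (a := 0) (b := y)
    (fun u : ℝ => Real.exp (-u ^ 2))
  simp only [neg_sq, neg_zero] at h
  rw [gaussPrimitive, gaussPrimitive, h, intervalIntegral.integral_symm]

theorem monotone_gaussPrimitive : Monotone gaussPrimitive := by
  refine monotone_of_deriv_nonneg (fun y => (hasDerivAt_gaussPrimitive y).differentiableAt) ?_
  intro y
  rw [(hasDerivAt_gaussPrimitive y).deriv]
  positivity

theorem tendsto_gaussPrimitive_atTop :
    Tendsto gaussPrimitive atTop (nhds (Real.sqrt π / 2)) := by
  have hi : MeasureTheory.IntegrableOn (fun u : ℝ => Real.exp (-u ^ 2)) (Ioi 0) := by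
    simpa using (integrable_exp_neg_mul_sq (b := 1) one_pos).integrableOn (s := Ioi 0)
  have h := MeasureTheory.intervalIntegral_tendsto_integral_Ioi 0 hi tendsto_id
  have hg := integral_gaussian_Ioi 1
  simp only [neg_mul, one_mul, div_one] at hg
  rw [hg] at h
  exact h

theorem gaussPrimitive_le (y : ℝ) : gaussPrimitive y ≤ Real.sqrt π / 2 :=
  monotone_gaussPrimitive.ge_of_tendsto tendsto_gaussPrimitive_atTop y

theorem abs_gaussPrimitive_le (y : ℝ) : |gaussPrimitive y| ≤ Real.sqrt π / 2 := by
  rw [abs_le]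
  have h := gaussPrimitive_le (-y)
  rw [gaussPrimitive_neg] at h
  exact ⟨by linarith, gaussPrimitive_le y⟩

/-- The self-similar profile of the solution of the heat equation starting from `√π |x|`. -/
noncomputable def heatProfile (y : ℝ) : ℝ := 2 * y * gaussPrimitive y + Real.exp (-y ^ 2)

theorem hasDerivAt_exp_neg_sq (y : ℝ) :
    HasDerivAt (fun u : ℝ => Real.exp (-u ^ 2)) (-2 * y * Real.exp (-y ^ 2)) y := by
  refine (((hasDerivAt_pow 2 y).neg).exp).congr_deriv ?_
  simp only [Pi.neg_apply]
  ring

theorem hasDerivAt_heatProfile (y : ℝ) :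
    HasDerivAt heatProfile (2 * gaussPrimitive y) y := by
  have h := (((hasDerivAt_id y).const_mul 2).mul (hasDerivAt_gaussPrimitive y)).add
    (hasDerivAt_exp_neg_sq y)
  refine h.congr_deriv ?_
  simp only [id]
  ring

theorem heatProfile_zero : heatProfile 0 = 1 := by simp [heatProfile]

theorem heatProfile_neg (y : ℝ) : heatProfile (-y) = heatProfile y := by
  simp [heatProfile, gaussPrimitive_neg]

theorem sqrt_pi_mul_le_heatProfile (y : ℝ) :
    Real.sqrt π * y ≤ heatProfile y := by
  have hd : ∀ R : ℝ, HasDerivAt (fun R => 2 * y * gaussPrimitive R + Real.exp (-R ^ 2))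
      (2 * y * Real.exp (-R ^ 2) + -2 * R * Real.exp (-R ^ 2)) R := fun R =>
    ((hasDerivAt_gaussPrimitive R).const_mul (2 * y)).add (hasDerivAt_exp_neg_sq R)
  have hanti : AntitoneOn (fun R => 2 * y * gaussPrimitive R + Real.exp (-R ^ 2)) (Ici y) := by
    refine antitoneOn_of_deriv_nonpos (convex_Ici y)
      (fun R _ => (hd R).continuousAt.continuousWithinAt)
      (fun R _ => (hd R).differentiableAt.differentiableWithinAt) ?_
    intro R hR
    rw [interior_Ici] at hR
    rw [(hd R).deriv]
    have hR' : y < R := hR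
    nlinarith [Real.exp_pos (-R ^ 2)]
  have hlim : Tendsto (fun R => 2 * y * gaussPrimitive R + Real.exp (-R ^ 2)) atTop
      (nhds (2 * y * (Real.sqrt π / 2) + 0)) := by
    refine (tendsto_gaussPrimitive_atTop.const_mul _).add ?_
    exact Real.tendsto_exp_neg_atTop_nhds_zero.comp (tendsto_pow_atTop two_ne_zero)
  have := le_of_tendsto hlim ((eventually_ge_atTop y).mono fun R hR =>
    hanti (mem_Ici.2 le_rfl) hR hR)
  simp only [heatProfile]
  linarith

theorem sqrt_pi_mul_abs_le_heatProfile (y : ℝ) : Real.sqrt π * |y| ≤ heatProfile y := by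
  rcases abs_cases y with ⟨h, _⟩ | ⟨h, _⟩
  · rw [h]; exact sqrt_pi_mul_le_heatProfile _
  · rw [h, ← heatProfile_neg]; exact sqrt_pi_mul_le_heatProfile _

/-- The solution of `∂ₛ W = A ∂²ₓ W` with initial datum `√π |x|`. -/
noncomputable def heatAbs (A x s : ℝ) : ℝ :=
  Real.sqrt (4 * A * s) * heatProfile (x / Real.sqrt (4 * A * s))

theorem sqrt_pi_mul_abs_le_heatAbs {A s : ℝ} (hA : 0 < A) (hs : 0 < s) (x : ℝ) :
    Real.sqrt π * |x| ≤ heatAbs A x s := by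
  have hr : 0 < Real.sqrt (4 * A * s) := Real.sqrt_pos.2 (by positivity)
  have h := mul_le_mul_of_nonneg_left
    (sqrt_pi_mul_abs_le_heatProfile (x / Real.sqrt (4 * A * s))) hr.le
  refine le_trans (le_of_eq ?_) h
  rw [abs_div, abs_of_pos hr]
  field_simp

theorem heatAbs_zero (A s : ℝ) : heatAbs A 0 s = Real.sqrt (4 * A * s) := by
  simp [heatAbs, heatProfile_zero]

theorem hasDerivAt_heatAbs_space {A s : ℝ} (hA : 0 < A) (hs : 0 < s) (x : ℝ) :
    HasDerivAt (fun x => heatAbs A x s) (2 * gaussPrimitive (x / Real.sqrt (4 * A * s))) x := by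
  have hr : 0 < Real.sqrt (4 * A * s) := Real.sqrt_pos.2 (by positivity)
  have h := ((hasDerivAt_heatProfile (x / Real.sqrt (4 * A * s))).comp x
    ((hasDerivAt_id x).div_const _)).const_mul (Real.sqrt (4 * A * s))
  refine h.congr_deriv ?_
  field_simp

theorem hasDerivAt_heatAbs_space_space (A s x : ℝ) :
    HasDerivAt (fun x => 2 * gaussPrimitive (x / Real.sqrt (4 * A * s)))
      (2 / Real.sqrt (4 * A * s) * Real.exp (-(x / Real.sqrt (4 * A * s)) ^ 2)) x := by
  have h := ((hasDerivAt_gaussPrimitive (x / Real.sqrt (4 * A * s))).comp x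
    ((hasDerivAt_id x).div_const _)).const_mul 2
  refine h.congr_deriv ?_
  ring

theorem hasDerivAt_heatAbs_time {A s : ℝ} (hA : 0 < A) (hs : 0 < s) (x : ℝ) :
    HasDerivAt (fun s => heatAbs A x s)
      (A * (2 / Real.sqrt (4 * A * s) * Real.exp (-(x / Real.sqrt (4 * A * s)) ^ 2))) s := by
  have hr : 0 < Real.sqrt (4 * A * s) := Real.sqrt_pos.2 (by positivity)
  have h1 : HasDerivAt (fun s => Real.sqrt (4 * A * s)) (2 * A / Real.sqrt (4 * A * s)) s := by
    have := ((hasDerivAt_id s).const_mul (4 * A)).sqrt (by simp only [id]; positivity)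
    refine this.congr_deriv ?_
    simp only [id]
    field_simp
    norm_num
  have h := h1.mul ((hasDerivAt_heatProfile (x / Real.sqrt (4 * A * s))).comp s
    ((hasDerivAt_const s x).div h1 hr.ne'))
  refine h.congr_deriv ?_
  simp only [heatProfile, Function.comp, Pi.div_apply]
  field_simp
  ring

theorem second_deriv_nonneg_of_isLocalMin {f : ℝ → ℝ} {x : ℝ} (h : IsLocalMin f x)
    (hf : ContinuousAt f x) : 0 ≤ deriv (deriv f) x := by
  by_contra! hneg
  have hmax := isLocalMax_of_deriv_deriv_neg hneg h.deriv_eq_zero hf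
  have hconst : f =ᶠ[nhds x] fun _ => f x := by
    filter_upwards [h, hmax] with y h1 h2 using le_antisymm h2 h1
  have h2 : deriv (deriv f) x = 0 := by
    rw [hconst.deriv.deriv_eq]
    simp
  linarith

theorem deriv_nonpos_of_forall_left_ge {f : ℝ → ℝ} {f' a t : ℝ} (hf : HasDerivAt f f' t)
    (hat : a < t) (h : ∀ s ∈ Icc a t, f t ≤ f s) : f' ≤ 0 := by
  refine le_of_tendsto (hf.tendsto_slope.mono_left
    (nhdsWithin_mono t (fun s (hs : s ∈ Iio t) => (ne_of_lt hs : s ≠ t)))) ?_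
  filter_upwards [Ioo_mem_nhdsLT hat] with s hs
  rw [slope_def_field]
  exact div_nonpos_of_nonneg_of_nonpos (sub_nonneg.2 (h s ⟨hs.1.le, hs.2.le⟩))
    (by linarith [hs.2])

/-- Comparison with a smooth subsolution: it suffices to check the subsolution
inequality in the interior and the ordering on the parabolic boundary. -/
theorem le_of_parabolic_subsolution {α : ℝ → ℝ} (hα : ∀ p, 0 < α p) {b t₁ t₂ : ℝ}
    (ht₁ : 0 ≤ t₁) {v w wx wxx wt : ℝ → ℝ → ℝ}
    (hreg : RegularOn v (Icc 0 b ×ˢ Ici 0))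
    (heq : ∀ z ∈ Icc (0:ℝ) b, ∀ t ∈ Ici (0:ℝ),
      pderivT v z t = α (pderivX v z t) * pderivXX v z t)
    (hwc : ContinuousOn (fun p : ℝ × ℝ => w p.1 p.2) (Icc 0 b ×ˢ Icc t₁ t₂))
    (hwx : ∀ z, ∀ t ∈ Icc t₁ t₂, HasDerivAt (fun y => w y t) (wx z t) z)
    (hwxx : ∀ z, ∀ t ∈ Icc t₁ t₂, HasDerivAt (fun y => wx y t) (wxx z t) z)
    (hwt : ∀ z, ∀ t ∈ Icc t₁ t₂, HasDerivAt (fun s => w z s) (wt z t) t)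
    (hsub : ∀ z, ∀ t ∈ Icc t₁ t₂, wt z t ≤ α (wx z t) * wxx z t)
    (hinit : ∀ z ∈ Icc 0 b, w z t₁ ≤ v z t₁)
    (hleft : ∀ t ∈ Icc t₁ t₂, w 0 t ≤ v 0 t) (hright : ∀ t ∈ Icc t₁ t₂, w b t ≤ v b t)
    {z t : ℝ} (hz : z ∈ Icc 0 b) (ht : t ∈ Icc t₁ t₂) : w z t ≤ v z t := by
  obtain ⟨hvc, hvx, hvxx, hvt, -, -, -⟩ := hreg
  have key : ∀ ε > 0, 0 ≤ v z t - w z t + ε * (t - t₁) := by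
    intro ε hε
    have hcont : ContinuousOn (fun p : ℝ × ℝ => v p.1 p.2 - w p.1 p.2 + ε * (p.2 - t₁))
        (Icc 0 b ×ˢ Icc t₁ t₂) := by
      refine ((hvc.mono ?_).sub hwc).add (by fun_prop)
      exact prod_mono le_rfl fun s hs => ht₁.trans hs.1
    obtain ⟨⟨x, τ⟩, ⟨hx, hτ⟩, hmin⟩ :=
      (isCompact_Icc.prod isCompact_Icc).exists_isMinOn ⟨(z, t), hz, ht⟩ hcont
    have hmin' : ∀ y ∈ Icc 0 b, ∀ s ∈ Icc t₁ t₂,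
        v x τ - w x τ + ε * (τ - t₁) ≤ v y s - w y s + ε * (s - t₁) :=
      fun y hy s hs => hmin (show (y, s) ∈ Icc 0 b ×ˢ Icc t₁ t₂ from ⟨hy, hs⟩)
    refine le_trans ?_ (hmin' z hz t ht)
    simp only at hx hτ
    by_contra! hneg
    have hετ : 0 ≤ ε * (τ - t₁) := mul_nonneg hε.le (by linarith [hτ.1])
    have hτ1 : t₁ < τ := by
      refine lt_of_le_of_ne hτ.1 ?_
      rintro rfl
      linarith [hinit x hx]
    have hx0 : 0 < x := by
      refine lt_of_le_of_ne hx.1 ?_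
      rintro rfl
      linarith [hleft τ hτ]
    have hxb : x < b := by
      refine lt_of_le_of_ne hx.2 ?_
      rintro rfl
      linarith [hright τ hτ]
    have hτ0 : τ ∈ Ici (0:ℝ) := ht₁.trans hτ.1
    have hnhds : Ioo 0 b ∈ nhds x := Ioo_mem_nhds hx0 hxb
    have hlm : IsLocalMin (fun y => v y τ - w y τ) x := by
      filter_upwards [hnhds] with y hy
      linarith [hmin' y ⟨hy.1.le, hy.2.le⟩ τ hτ]
    have hd : ∀ y ∈ Ioo 0 b,
        HasDerivAt (fun y => v y τ - w y τ) (pderivX v y τ - wx y τ) y := fun y hy =>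
      (hvx (y, τ) ⟨⟨hy.1.le, hy.2.le⟩, hτ0⟩).hasDerivAt.sub (hwx y τ hτ)
    have hfx := hd x ⟨hx0, hxb⟩
    have h1 : pderivX v x τ - wx x τ = 0 := hlm.hasDerivAt_eq_zero hfx
    have h2 : 0 ≤ pderivXX v x τ - wxx x τ := by
      have := second_deriv_nonneg_of_isLocalMin hlm hfx.continuousAt
      have he : deriv (fun y => v y τ - w y τ) =ᶠ[nhds x] fun y => pderivX v y τ - wx y τ := by
        filter_upwards [hnhds] with y hy using (hd y hy).deriv
      have hd2 : HasDerivAt (fun y => pderivX v y τ - wx y τ) (pderivXX v x τ - wxx x τ) x :=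
        (hvxx (x, τ) ⟨hx, hτ0⟩).hasDerivAt.sub (hwxx x τ hτ)
      rwa [he.deriv_eq, hd2.deriv] at this
    have h3 : pderivT v x τ - wt x τ + ε * 1 ≤ 0 := by
      refine deriv_nonpos_of_forall_left_ge (a := t₁) (t := τ)
        (f := fun s => v x s - w x s + ε * (s - t₁)) ?_ hτ1 ?_
      · exact ((hvt (x, τ) ⟨hx, hτ0⟩).hasDerivAt.sub (hwt x τ hτ)).add
          (((hasDerivAt_id τ).sub_const t₁).const_mul ε)
      · exact fun s hs => hmin' x hx s ⟨hs.1, hs.2.trans hτ.2⟩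
    rw [heq x hx τ hτ0, sub_eq_zero.1 h1] at h3
    have h4 := hsub x τ hτ
    nlinarith [mul_nonneg (hα (wx x τ)).le h2]
  have hlim : Tendsto (fun ε : ℝ => v z t - w z t + ε * (t - t₁)) (nhdsWithin 0 (Ioi 0))
      (nhds (v z t - w z t + 0 * (t - t₁))) :=
    (Continuous.tendsto (by fun_prop) 0).mono_left nhdsWithin_le_nhds
  have := ge_of_tendsto hlim (eventually_nhdsWithin_of_forall fun ε hε => key ε hε)
  linarith

theorem ConcaveOn.sub_mul_abs_le {f : ℝ → ℝ} {b C z₀ z : ℝ} (hf : ConcaveOn ℝ (Icc 0 b) f)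
    (h0 : f 0 = 0) (hb : f b = 0) (hz₀ : z₀ ∈ Ioo 0 b) (hl : f z₀ ≤ C * z₀)
    (hr : f z₀ ≤ C * (b - z₀)) (hz : z ∈ Icc 0 b) : f z₀ - C * |z - z₀| ≤ f z := by
  obtain ⟨hp, hq⟩ := hz₀
  rcases le_total z z₀ with h | h
  · have hc := hf.2 (show (0:ℝ) ∈ Icc 0 b from ⟨le_rfl, by linarith⟩)
      (show z₀ ∈ Icc 0 b from ⟨hp.le, hq.le⟩) (show 0 ≤ 1 - z / z₀ from sub_nonneg.2 ((div_le_one hp).2 h))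
      (div_nonneg hz.1 hp.le) (by ring)
    simp only [smul_eq_mul, mul_zero, zero_add, h0, div_mul_cancel₀ z hp.ne'] at hc
    rw [abs_of_nonpos (by linarith)]
    refine le_trans ?_ hc
    have he : z / z₀ * f z₀ = f z₀ - f z₀ * ((z₀ - z) / z₀) := by field_simp; ring
    have : f z₀ * ((z₀ - z) / z₀) ≤ C * z₀ * ((z₀ - z) / z₀) :=
      mul_le_mul_of_nonneg_right hl (div_nonneg (by linarith) hp.le)
    have h2 : C * z₀ * ((z₀ - z) / z₀) = C * (z₀ - z) := by field_simp
    linarith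
  · have hp' : 0 < b - z₀ := by linarith
    have hc := hf.2 (show b ∈ Icc 0 b from ⟨by linarith, le_rfl⟩)
      (show z₀ ∈ Icc 0 b from ⟨hp.le, hq.le⟩)
      (show 0 ≤ 1 - (b - z) / (b - z₀) from sub_nonneg.2 ((div_le_one hp').2 (by linarith)))
      (show 0 ≤ (b - z) / (b - z₀) from div_nonneg (by linarith [hz.2]) hp'.le) (by ring)
    have hpt : (1 - (b - z) / (b - z₀)) * b + (b - z) / (b - z₀) * z₀ = z := by
      field_simp; ring
    simp only [smul_eq_mul, hpt, hb, mul_zero, zero_add] at hc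
    rw [abs_of_nonneg (by linarith)]
    refine le_trans ?_ hc
    have he : (b - z) / (b - z₀) * f z₀ = f z₀ - f z₀ * ((z - z₀) / (b - z₀)) := by
      field_simp; ring
    have : f z₀ * ((z - z₀) / (b - z₀)) ≤ C * (b - z₀) * ((z - z₀) / (b - z₀)) :=
      mul_le_mul_of_nonneg_right hr (div_nonneg (by linarith) hp'.le)
    have h2 : C * (b - z₀) * ((z - z₀) / (b - z₀)) = C * (z - z₀) := by field_simp
    linarith

theorem time_continuity_estimate
    (α : ℝ → ℝ) (hα : Continuous α) (hαpos : ∀ p, 0 < α p)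
    (L M : ℝ) (hL : 0 < L) (hM : 0 < M) (v : ℝ → ℝ → ℝ)
    (hreg : RegularOn v (Icc 0 (L/2) ×ˢ Ici 0))
    (heq : ∀ z ∈ Icc (0:ℝ) (L/2), ∀ t ∈ Ici (0:ℝ),
      pderivT v z t = α (pderivX v z t) * pderivXX v z t)
    (hconc : ∀ t ∈ Ici (0:ℝ), ConcaveOn ℝ (Icc 0 (L/2)) (fun z => v z t))
    (hbound : ∀ z ∈ Icc (0:ℝ) (L/2), ∀ t ∈ Ici (0:ℝ), 0 ≤ v z t ∧ v z t ≤ M)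
    (hbdry : ∀ t ∈ Ici (0:ℝ), v 0 t = 0 ∧ v (L/2) t = 0)
    (hmono : ∀ z ∈ Icc (0:ℝ) (L/2), ∀ t₁ t₂ : ℝ, 0 ≤ t₁ → t₁ ≤ t₂ → v z t₂ ≤ v z t₁) :
    ∀ δ ∈ Ioo (0:ℝ) (L/4), ∀ z ∈ Icc δ (L/2 - δ), ∀ t₁ t₂ : ℝ, 0 ≤ t₁ → t₁ ≤ t₂ →
      |v z t₂ - v z t₁| ≤
        2 * max (M / δ) (M / (L/2 - δ)) / Real.sqrt π *
          Real.sqrt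
            (sSup (α '' Icc (-(max (M / δ) (M / (L/2 - δ)))) (max (M / δ) (M / (L/2 - δ)))) *
              (t₂ - t₁)) := by
  intro δ hδ z hz t₁ t₂ ht₁ ht
  obtain ⟨hδ0, hδL⟩ := hδ
  set C := max (M / δ) (M / (L/2 - δ)) with hC
  set A := sSup (α '' Icc (-C) C) with hA
  have hCδ : M / δ ≤ C := le_max_left _ _
  have hC0 : 0 < C := lt_of_lt_of_le (by positivity) hCδ
  have hMC : M ≤ C * δ := (div_le_iff₀ hδ0).1 hCδ
  have hαA : ∀ p ∈ Icc (-C) C, α p ≤ A := fun p hp =>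
    le_csSup (isCompact_Icc.image hα).bddAbove (mem_image_of_mem α hp)
  have hA0 : 0 < A := (hαpos 0).trans_le (hαA 0 ⟨by linarith, hC0.le⟩)
  have hzI : z ∈ Icc (0:ℝ) (L/2) := ⟨by linarith [hz.1], by linarith [hz.2]⟩
  have hπ : 0 < Real.sqrt π := Real.sqrt_pos.2 Real.pi_pos
  have hM0 := (hbound z hzI t₁ ht₁).2
  have hMl : M ≤ C * z := hMC.trans (by gcongr; exact hz.1)
  have hMr : M ≤ C * (L/2 - z) := hMC.trans (by gcongr; linarith [hz.2])
  have hk : 0 ≤ C / Real.sqrt π := by positivity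
  have hw_le : ∀ x s : ℝ, 0 < s →
      v z t₁ - C / Real.sqrt π * heatAbs A (x - z) s ≤ v z t₁ - C * |x - z| := by
    intro x s hs
    have h := mul_le_mul_of_nonneg_left (sqrt_pi_mul_abs_le_heatAbs hA0 hs (x - z)) hk
    have he : C / Real.sqrt π * (Real.sqrt π * |x - z|) = C * |x - z| := by field_simp
    linarith
  have key : ∀ η > 0,
      v z t₁ - C / Real.sqrt π * Real.sqrt (4 * A * (t₂ - t₁ + η)) ≤ v z t₂ := by
    intro η hη
    have hpos : ∀ t ∈ Icc t₁ t₂, 0 < t - t₁ + η := fun t ht => by linarith [ht.1]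
    have hcmp := le_of_parabolic_subsolution (α := α) hαpos (b := L/2) (t₁ := t₁) (t₂ := t₂)
      ht₁ (v := v)
      (w := fun x t => v z t₁ - C / Real.sqrt π * heatAbs A (x - z) (t - t₁ + η))
      (wx := fun x t => -(C / Real.sqrt π *
        (2 * gaussPrimitive ((x - z) / Real.sqrt (4 * A * (t - t₁ + η))))))
      (wxx := fun x t => -(C / Real.sqrt π * (2 / Real.sqrt (4 * A * (t - t₁ + η)) *
        Real.exp (-((x - z) / Real.sqrt (4 * A * (t - t₁ + η))) ^ 2))))
      (wt := fun x t => -(C / Real.sqrt π * (A * (2 / Real.sqrt (4 * A * (t - t₁ + η)) *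
        Real.exp (-((x - z) / Real.sqrt (4 * A * (t - t₁ + η))) ^ 2)))))
      hreg heq ?_ ?_ ?_ ?_ ?_ ?_ ?_ ?_ hzI (t := t₂) ⟨ht, le_rfl⟩
    · simpa [heatAbs_zero] using hcmp
    · have hP : Continuous heatProfile :=
        continuous_iff_continuousAt.2 fun y => (hasDerivAt_heatProfile y).continuousAt
      have hr : ∀ p ∈ Icc 0 (L/2) ×ˢ Icc t₁ t₂,
          Real.sqrt (4 * A * ((p : ℝ × ℝ).2 - t₁ + η)) ≠ 0 := fun p hp =>
        (Real.sqrt_pos.2 (mul_pos (by positivity) (hpos _ hp.2))).ne'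
      refine continuousOn_const.sub (continuousOn_const.mul ?_)
      unfold heatAbs
      refine ContinuousOn.mul (by fun_prop) (hP.comp_continuousOn ?_)
      exact ContinuousOn.div (by fun_prop) (by fun_prop) hr
    · intro x t ht
      exact (((hasDerivAt_heatAbs_space hA0 (hpos t ht) (x - z)).comp_sub_const x z).const_mul
        (C / Real.sqrt π)).const_sub (v z t₁)
    · intro x t ht
      exact (((hasDerivAt_heatAbs_space_space A (t - t₁ + η) (x - z)).comp_sub_const x z).const_mul
        (C / Real.sqrt π)).neg
    · intro x t ht
      have h1 : HasDerivAt (fun s => s - t₁ + η) 1 t :=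
        ((hasDerivAt_id t).sub_const t₁).add_const η
      have h2 := (hasDerivAt_heatAbs_time hA0 (hpos t ht) (x - z)).comp t h1
      rw [mul_one] at h2
      exact (h2.const_mul (C / Real.sqrt π)).const_sub (v z t₁)
    · intro x t ht
      set G := C / Real.sqrt π * (2 / Real.sqrt (4 * A * (t - t₁ + η)) *
        Real.exp (-((x - z) / Real.sqrt (4 * A * (t - t₁ + η))) ^ 2)) with hG
      have hG0 : 0 ≤ G := by positivity
      set e := gaussPrimitive ((x - z) / Real.sqrt (4 * A * (t - t₁ + η))) with he
      have hle : |(-(C / Real.sqrt π * (2 * e)))| ≤ C := by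
        rw [abs_neg, abs_mul, abs_mul, abs_of_nonneg hk, abs_two]
        calc C / Real.sqrt π * (2 * |e|) ≤ C / Real.sqrt π * (2 * (Real.sqrt π / 2)) := by
              gcongr
              exact abs_gaussPrimitive_le _
          _ = C := by field_simp
      have := mul_le_mul_of_nonneg_right (hαA _ (abs_le.1 hle)) hG0
      linarith
    · intro x hx
      refine (hw_le x _ (hpos t₁ ⟨le_rfl, ht⟩)).trans ?_
      exact (hconc t₁ ht₁).sub_mul_abs_le (hbdry t₁ ht₁).1 (hbdry t₁ ht₁).2
        ⟨by linarith [hz.1], by linarith [hz.2]⟩ (hM0.trans hMl) (hM0.trans hMr) hx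
    · intro t ht
      rw [(hbdry t (ht₁.trans ht.1)).1]
      refine (hw_le 0 _ (hpos t ht)).trans ?_
      rw [zero_sub, abs_neg, abs_of_nonneg hzI.1]
      linarith
    · intro t ht
      rw [(hbdry t (ht₁.trans ht.1)).2]
      refine (hw_le (L/2) _ (hpos t ht)).trans ?_
      rw [abs_of_nonneg (by linarith [hzI.2])]
      linarith
  have hlim : Tendsto (fun η : ℝ => v z t₁ - C / Real.sqrt π *
      Real.sqrt (4 * A * (t₂ - t₁ + η))) (nhdsWithin 0 (Ioi 0))
      (nhds (v z t₁ - C / Real.sqrt π * Real.sqrt (4 * A * (t₂ - t₁ + 0)))) :=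
    (Continuous.tendsto (by fun_prop) 0).mono_left nhdsWithin_le_nhds
  have hfin := le_of_tendsto hlim (eventually_nhdsWithin_of_forall fun η hη => key η hη)
  have hsq : Real.sqrt (4 * A * (t₂ - t₁ + 0)) = 2 * Real.sqrt (A * (t₂ - t₁)) := by
    rw [add_zero, mul_assoc, Real.sqrt_mul (by norm_num),
      show (4:ℝ) = 2 ^ 2 by norm_num, Real.sqrt_sq (by norm_num)]
  rw [hsq] at hfin
  rw [abs_of_nonpos (by linarith [hmono z hzI t₁ t₂ ht₁ ht])]
  have he : C / Real.sqrt π * (2 * Real.sqrt (A * (t₂ - t₁))) =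
      2 * C / Real.sqrt π * Real.sqrt (A * (t₂ - t₁)) := by ring
  linarith
end

section
/- Let L > 0 and let v : ℝ → ℝ be continuous, L-periodic, odd (v(−x) = −v(x)), and concave and positive on (0,L/2). Then v is its own modulus of continuity: for all x, y with 0 < y − x < L one has −2v((L+x−y)/2) ≤ v(y) − v(x) ≤ 2v((y−x)/2). -/
open Set Real Filter

theorem ConcaveOn.closure_of_continuous {s : Set ℝ} {f : ℝ → ℝ} (hf : ConcaveOn ℝ s f)
    (hc : Continuous f) : ConcaveOn ℝ (closure s) f := by
  refine ⟨hf.1.closure, fun x hx y hy a b ha hb hab => ?_⟩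
  have hclosed : IsClosed {p : ℝ × ℝ | a • f p.1 + b • f p.2 ≤ f (a • p.1 + b • p.2)} :=
    isClosed_le (by fun_prop) (by fun_prop)
  have hsub : s ×ˢ s ⊆ {p : ℝ × ℝ | a • f p.1 + b • f p.2 ≤ f (a • p.1 + b • p.2)} :=
    fun p hp => hf.2 hp.1 hp.2 ha hb hab
  have hmem : (x, y) ∈ closure (s ×ˢ s) := by
    rw [closure_prod_eq]
    exact ⟨hx, hy⟩
  exact hclosed.closure_subset_iff.2 hsub hmem

theorem ConcaveOn.mul_le_of_map_zero {c : ℝ} {h : ℝ → ℝ} (hh : ConcaveOn ℝ (Icc 0 c) h)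
    (h0 : h 0 = 0) {a b : ℝ} (ha : 0 ≤ a) (hab : a ≤ b) (hb : 0 < b) (hbc : b ≤ c) :
    a / b * h b ≤ h a := by
  have key := hh.2 (x := b) (y := 0) ⟨hb.le, hbc⟩ ⟨le_rfl, hb.le.trans hbc⟩
    (div_nonneg ha hb.le) (sub_nonneg.2 ((div_le_one hb).2 hab)) (by ring)
  simpa [h0, div_mul_cancel₀ a hb.ne'] using key

theorem ConcaveOn.subadditive_of_map_zero {c : ℝ} {h : ℝ → ℝ} (hh : ConcaveOn ℝ (Icc 0 c) h)
    (h0 : h 0 = 0) {a b : ℝ} (ha : 0 ≤ a) (hb : 0 ≤ b) (habc : a + b ≤ c) :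
    h (a + b) ≤ h a + h b := by
  rcases (add_nonneg ha hb).eq_or_lt with hz | hpos
  · obtain rfl : a = 0 := by linarith
    simp [h0]
  · have h₁ := hh.mul_le_of_map_zero h0 ha (le_add_of_nonneg_right hb) hpos habc
    have h₂ := hh.mul_le_of_map_zero h0 hb (le_add_of_nonneg_left ha) hpos habc
    have h₃ : a / (a + b) * h (a + b) + b / (a + b) * h (a + b) = h (a + b) := by
      field_simp
    linarith

theorem ConcaveOn.map_add_le_map_sub_add_two_mul {c : ℝ} {h : ℝ → ℝ}
    (hh : ConcaveOn ℝ (Icc 0 c) h) (h0 : h 0 = 0) {t m : ℝ} (ht : 0 ≤ t) (htm : t ≤ m)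
    (hmc : m + t ≤ c) : h (m + t) ≤ h (m - t) + 2 * h t := by
  have h₁ := hh.subadditive_of_map_zero h0 (a := m - t) (b := t + t)
    (by linarith) (by linarith) (by linarith)
  have h₂ := hh.subadditive_of_map_zero h0 ht ht (by linarith)
  rw [show m - t + (t + t) = m + t by ring] at h₁
  linarith

/-- For an odd, `L`-periodic function that is concave and nonnegative on a half period, the
symmetric sum about `s` is largest at `s` itself. -/
theorem map_add_add_map_sub_le {L : ℝ} {v : ℝ → ℝ} (hper : ∀ x, v (x + L) = v x)
    (hodd : ∀ x, v (-x) = -v x) (hconc : ConcaveOn ℝ (Icc 0 (L / 2)) v)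
    (hnonneg : ∀ x ∈ Icc 0 (L / 2), 0 ≤ v x) {s m : ℝ} (hs : s ∈ Icc 0 (L / 2))
    (hm : m ∈ Icc 0 (L / 2)) : v (s + m) + v (s - m) ≤ 2 * v s := by
  obtain ⟨hs0, hsL⟩ := hs
  obtain ⟨hm0, hmL⟩ := hm
  have hrefl : ∀ x, v (L - x) = -v x := fun x => by
    rw [← hodd, ← hper (-x)]
    congr 1
    ring
  have hv0 : v 0 = 0 := by
    have := hodd 0
    rw [neg_zero] at this
    linarith
  have hvL : v (L / 2) = 0 := by
    have := hrefl (L / 2)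
    rw [show L - L / 2 = L / 2 by ring] at this
    linarith
  rcases le_total m s with hms | hms <;> rcases le_total (s + m) (L / 2) with hsm | hsm
  · have := hconc.2 (show s + m ∈ Icc 0 (L / 2) from ⟨by linarith, hsm⟩)
      (show s - m ∈ Icc 0 (L / 2) from ⟨by linarith, by linarith⟩)
      (show (0 : ℝ) ≤ 1 / 2 by norm_num) (show (0 : ℝ) ≤ 1 / 2 by norm_num) (by norm_num)
    simp only [smul_eq_mul] at this
    rw [show 1 / 2 * (s + m) + 1 / 2 * (s - m) = s by ring] at this
    linarith
  · have hconc' : ConcaveOn ℝ (Icc 0 (L / 2)) fun z => v (L / 2 - z) := by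
      refine ⟨convex_Icc _ _, fun x hx y hy a b ha hb hab => ?_⟩
      have := hconc.2 (x := L / 2 - x) (y := L / 2 - y) ⟨by linarith [hx.2], by linarith [hx.1]⟩
        ⟨by linarith [hy.2], by linarith [hy.1]⟩ ha hb hab
      convert this using 2
      simp only [smul_eq_mul]
      linear_combination (-(L / 2)) * hab
    have := hconc'.map_add_le_map_sub_add_two_mul (by simpa using hvL) (t := L / 2 - s) (m := m)
      (by linarith) (by linarith) (by linarith)
    rw [show L / 2 - (m + (L / 2 - s)) = s - m by ring,
      show L / 2 - (m - (L / 2 - s)) = L - (s + m) by ring,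
      show L / 2 - (L / 2 - s) = s by ring, hrefl] at this
    linarith
  · have := hconc.map_add_le_map_sub_add_two_mul hv0 hs0 hms (by linarith)
    rw [← neg_sub m s, hodd, add_comm s m]
    linarith
  · have h₁ := hnonneg (m - s) ⟨by linarith, by linarith⟩
    have h₂ := hnonneg (L - (s + m)) ⟨by linarith, by linarith⟩
    have h₃ := hnonneg s ⟨hs0, hsL⟩
    rw [hrefl] at h₂
    rw [← neg_sub m s, hodd]
    linarith

theorem odd_concave_periodic_own_modulus
    (L : ℝ) (hL : 0 < L) (v : ℝ → ℝ)
    (hvcont : Continuous v)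
    (hvper : ∀ x : ℝ, v (x + L) = v x)
    (hvodd : ∀ x : ℝ, v (-x) = -v x)
    (hvconc : ConcaveOn ℝ (Ioo 0 (L/2)) v)
    (hvpos : ∀ x ∈ Ioo (0:ℝ) (L/2), 0 < v x) :
    IsModulus L v v := by
  have hcl : closure (Ioo 0 (L / 2)) = Icc 0 (L / 2) := closure_Ioo (by linarith)
  have hconc : ConcaveOn ℝ (Icc 0 (L / 2)) v := hcl ▸ hvconc.closure_of_continuous hvcont
  have hnonneg : ∀ x ∈ Icc 0 (L / 2), 0 ≤ v x := by
    rw [← hcl]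
    exact (isClosed_le continuous_const hvcont).closure_subset_iff.2 fun x hx => (hvpos x hx).le
  have upper : ∀ x y : ℝ, 0 < y - x → y - x < L → v y - v x ≤ 2 * v ((y - x) / 2) := by
    intro x y h₀ h₁
    set s := (y - x) / 2 with hs
    have hsmem : s ∈ Icc 0 (L / 2) := ⟨by linarith, by linarith⟩
    have hf : Function.Periodic (fun m => v (s + m) + v (s - m)) L := fun m => by
      have h₂ := hvper (s + m)
      have h₃ := hvper (s - (m + L))
      rw [show s - (m + L) + L = s - m by ring] at h₃
      simp only [← add_assoc, h₂, h₃]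
    obtain ⟨m, hm, hfm⟩ := hf.exists_mem_Ico hL ((x + y) / 2) (-(L / 2))
    rw [show s + (x + y) / 2 = y by rw [hs]; ring,
      show s - (x + y) / 2 = -x by rw [hs]; ring, hvodd] at hfm
    rcases le_total 0 m with hm0 | hm0
    · have := map_add_add_map_sub_le hvper hvodd hconc hnonneg hsmem
        (m := m) ⟨hm0, by linarith [hm.2]⟩
      linarith
    · have := map_add_add_map_sub_le hvper hvodd hconc hnonneg hsmem
        (m := -m) ⟨by linarith, by linarith [hm.1]⟩
      rw [sub_neg_eq_add, ← sub_eq_add_neg] at this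
      linarith
  intro x y h₀ h₁
  refine ⟨?_, upper x y h₀ h₁⟩
  have := upper y (x + L) (by linarith) (by linarith)
  rw [hvper, add_comm x L] at this
  linarith
end
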